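/- arXiv:2103.07079 — 3 statements merged into one kernel-verified Lean document; each statement's English description precedes it below -/
import Mathlib

section
/- Let n ≥ 2 and let M_1, …, M_n be real symmetric d×d matrices satisfying Σ_{i,j ∈ [n], i ≠ j} (M_i M_j − M_j M_i)^2 ≺ 0 (i.e., the sum of squared commutators over all ordered pairs of distinct indices is negative definite). Then for every integer K ≥ 1 there exists η_max ∈ (0,1] such that for every η ∈ [0, η_max], the matrices A_i := I − η M_i satisfy ‖W_SS(n,K,A_1,…,A_n)‖ ≤ ‖W_RS(n,K,A_1,…,A_n)‖. -/
/-- Spectral norm (operator 2-norm) of a real square matrix. -/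
noncomputable def specNorm {d : ℕ} (A : Matrix (Fin d) (Fin d) ℝ) : ℝ :=
  ‖Matrix.toEuclideanCLM (𝕜 := ℝ) A‖

/-- Ordered product `A (σ 1) * A (σ 2) * ⋯ * A (σ n)` (increasing index order). -/
noncomputable def permProd {n d : ℕ} (A : Fin n → Matrix (Fin d) (Fin d) ℝ)
    (σ : Equiv.Perm (Fin n)) : Matrix (Fin d) (Fin d) ℝ :=
  (List.ofFn fun i => A (σ i)).prod

/-- Single-shuffle mean: `(1/n!) Σ_σ (Π_i A_{σ(i)})^K`. -/
noncomputable def WSS (n K : ℕ) {d : ℕ} (A : Fin n → Matrix (Fin d) (Fin d) ℝ) :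
    Matrix (Fin d) (Fin d) ℝ :=
  ((n.factorial : ℝ)⁻¹) • ∑ σ : Equiv.Perm (Fin n), (permProd A σ) ^ K

/-- Random-reshuffle mean: `((1/n!) Σ_σ Π_i A_{σ(i)})^K`. -/
noncomputable def WRS (n K : ℕ) {d : ℕ} (A : Fin n → Matrix (Fin d) (Fin d) ℝ) :
    Matrix (Fin d) (Fin d) ℝ :=
  (((n.factorial : ℝ)⁻¹) • ∑ σ : Equiv.Perm (Fin n), permProd A σ) ^ K

/-- GD mean: `((1/n) Σ_i A_i)^(nK)`. -/
noncomputable def WGD (n K : ℕ) {d : ℕ} (A : Fin n → Matrix (Fin d) (Fin d) ℝ) :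
    Matrix (Fin d) (Fin d) ℝ :=
  (((n : ℝ)⁻¹) • ∑ i : Fin n, A i) ^ (n * K)

open Filter Topology Matrix

section Expansion

variable {R : Type*} [Ring R]

/-- The sum of `l i * l j` over positions `i < j` of the list `l`. -/
def List.pairSum : List R → R
  | [] => 0
  | a :: l => List.pairSum l + a * l.sum

lemma List.pairSum_cons_cons_sub (a b : R) (l : List R) :
    List.pairSum (a :: b :: l) - List.pairSum (b :: a :: l) = a * b - b * a := by
  simp only [List.pairSum, List.sum_cons]
  noncomm_ring

variable [Algebra ℝ R] [TopologicalSpace R] [IsTopologicalRing R] [ContinuousSMul ℝ R]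

lemma List.exists_prod_one_sub_smul_expansion (l : List R) :
    ∃ r : ℝ → R, Continuous r ∧ r 0 = l.pairSum ∧
      ∀ η : ℝ, (l.map fun a => 1 - η • a).prod = 1 - η • l.sum + η ^ 2 • r η := by
  induction l with
  | nil => exact ⟨0, continuous_zero, by simp [List.pairSum], by simp⟩
  | cons a l ih =>
    obtain ⟨r, hr, hr0, hl⟩ := ih
    refine ⟨fun η => r η + a * l.sum - η • (a * r η), by fun_prop, ?_, fun η => ?_⟩
    · simp [List.pairSum, hr0]
    · rw [List.map_cons, List.prod_cons, hl, List.sum_cons]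
      simp only [sub_mul, mul_add, mul_sub, smul_mul_assoc, mul_smul_comm, one_mul, mul_one]
      module

lemma exists_add_smul_pow_expansion (K : ℕ) :
    ∃ (L : R → R →ₗ[ℝ] R) (Q : R → R → ℝ → R),
      Continuous (fun x : R × R => L x.1 x.2) ∧
      Continuous (fun x : R × R × ℝ => Q x.1 x.2.1 x.2.2) ∧
      (∀ G, L 1 G = (K : ℝ) • G) ∧
      (∀ G, Q 1 G 0 = (K.choose 2 : ℝ) • (G * G)) ∧
      ∀ P G t, (P + t • G) ^ K = P ^ K + t • L P G + t ^ 2 • Q P G t := by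
  induction K with
  | zero =>
    refine ⟨0, 0, ?_, ?_, ?_, ?_, ?_⟩
    · simpa using continuous_const
    · simpa using continuous_const
    all_goals simp
  | succ K ih =>
    obtain ⟨L, Q, hL, hQ, hL1, hQ1, h⟩ := ih
    refine ⟨fun P => (LinearMap.mulRight ℝ P) ∘ₗ L P + LinearMap.mulLeft ℝ (P ^ K),
      fun P G t => Q P G t * (P + t • G) + L P G * G, ?_, ?_, fun G => ?_, fun G => ?_,
      fun P G t => ?_⟩
    · simp only [LinearMap.add_apply, LinearMap.comp_apply, LinearMap.mulRight_apply,
        LinearMap.mulLeft_apply]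
      fun_prop
    · have hL' : Continuous fun x : R × R × ℝ => L x.1 x.2.1 :=
        hL.comp (continuous_fst.prodMk (continuous_fst.comp continuous_snd))
      fun_prop
    · simp [hL1, add_smul]
    · simp only [hQ1, hL1, zero_smul, add_zero, mul_one, smul_mul_assoc, ← add_smul]
      congr 1
      rw [Nat.choose_succ_succ' K 1, Nat.choose_one_right]
      push_cast
      ring
    · rw [pow_succ _ K, h, pow_succ P K]
      simp only [LinearMap.add_apply, LinearMap.comp_apply, LinearMap.mulRight_apply,
        LinearMap.mulLeft_apply, add_mul, mul_add, smul_mul_assoc, mul_smul_comm]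
      module

end Expansion

lemma List.pairSum_add_transpose {ι : Type*} [Fintype ι] [DecidableEq ι] (l : List (Matrix ι ι ℝ))
    (hl : ∀ A ∈ l, A.IsSymm) :
    l.pairSum + l.pairSumᵀ = l.sum * l.sum - (l.map fun A => A * A).sum := by
  induction l with
  | nil => simp [List.pairSum]
  | cons A l ih =>
    have hA : Aᵀ = A := hl A List.mem_cons_self
    have hl' : ∀ B ∈ l, B.IsSymm := fun B hB => hl B (List.mem_cons_of_mem A hB)
    have hs : l.sumᵀ = l.sum := by
      rw [transpose_list_sum, List.map_congr_left (g := id) hl', List.map_id]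
    have := ih hl'
    simp only [List.pairSum, List.sum_cons, List.map_cons, transpose_add, transpose_mul, hA, hs]
    calc _ = l.pairSum + l.pairSumᵀ + (A * l.sum + l.sum * A) := by abel
      _ = _ := by rw [this]; noncomm_ring

lemma eventually_forall_dotProduct_mulVec_nonpos {ι : Type*} [Fintype ι]
    {N : ℝ → Matrix ι ι ℝ} (hN : Continuous N) (h0 : ∀ x ≠ 0, x ⬝ᵥ N 0 *ᵥ x < 0) :
    ∀ᶠ η in 𝓝 0, ∀ x, x ⬝ᵥ N η *ᵥ x ≤ 0 := by
  have hc : Continuous fun p : ℝ × (ι → ℝ) => p.2 ⬝ᵥ N p.1 *ᵥ p.2 := by fun_prop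
  have hs : ∀ᶠ η in 𝓝 (0 : ℝ), ∀ x ∈ Metric.sphere (0 : ι → ℝ) 1, x ⬝ᵥ N η *ᵥ x < 0 := by
    refine (isCompact_sphere 0 1).eventually_forall_of_forall_eventually fun x hx => ?_
    exact hc.continuousAt.eventually_lt continuousAt_const
      (h0 x (ne_zero_of_mem_unit_sphere ⟨x, hx⟩))
  filter_upwards [hs] with η hη x
  rcases eq_or_ne x 0 with rfl | hx
  · simp
  · have hx' := norm_ne_zero_iff.mpr hx
    have := hη (‖x‖⁻¹ • x) (by simp [norm_smul, hx'])
    simp only [mulVec_smul, dotProduct_smul, smul_dotProduct, smul_eq_mul] at this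
    have hpos : 0 < ‖x‖⁻¹ := by positivity
    by_contra! hlt
    exact absurd this (not_lt.mpr (by positivity))

lemma specNorm_le_of_forall_dotProduct_le {d : ℕ} {A B : Matrix (Fin d) (Fin d) ℝ}
    (h : ∀ x, (A *ᵥ x) ⬝ᵥ (A *ᵥ x) ≤ (B *ᵥ x) ⬝ᵥ (B *ᵥ x)) : specNorm A ≤ specNorm B := by
  refine ContinuousLinearMap.opNorm_le_bound _ (norm_nonneg _) fun x => ?_
  refine le_trans ?_ (ContinuousLinearMap.le_opNorm _ x)
  rw [← sq_le_sq₀ (norm_nonneg _) (norm_nonneg _), EuclideanSpace.real_norm_sq_eq,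
    EuclideanSpace.real_norm_sq_eq]
  simpa [dotProduct, sq] using h x.ofLp

/-- If `s ≥ 0` and `2 Wᵀ H + s Hᵀ H` has nonpositive quadratic form, then `W + s • H` has
spectral norm at most that of `W`. -/
lemma specNorm_add_smul_le {d : ℕ} {W H : Matrix (Fin d) (Fin d) ℝ} {s : ℝ} (hs : 0 ≤ s)
    (h : ∀ x, x ⬝ᵥ ((2 : ℝ) • (Wᵀ * H) + s • (Hᵀ * H)) *ᵥ x ≤ 0) :
    specNorm (W + s • H) ≤ specNorm W := by
  refine specNorm_le_of_forall_dotProduct_le fun x => ?_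
  have hT (U V : Matrix (Fin d) (Fin d) ℝ) : x ⬝ᵥ (Uᵀ * V) *ᵥ x = (U *ᵥ x) ⬝ᵥ (V *ᵥ x) := by
    rw [← mulVec_mulVec, dotProduct_mulVec, vecMul_transpose]
  have hx := h x
  simp only [add_mulVec, smul_mulVec, dotProduct_add, dotProduct_smul, hT, smul_eq_mul] at hx
  simp only [add_mulVec, smul_mulVec, dotProduct_add, add_dotProduct, dotProduct_smul,
    smul_dotProduct, smul_eq_mul, dotProduct_comm (H *ᵥ x) (W *ᵥ x)]
  nlinarith [mul_nonneg hs (neg_nonneg.mpr hx)]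

lemma exists_perm_apply_eq {α : Type*} [DecidableEq α] {a b i j : α} (hab : a ≠ b) (hij : i ≠ j) :
    ∃ σ : Equiv.Perm α, σ a = i ∧ σ b = j := by
  refine ⟨Equiv.swap a i * Equiv.swap b (Equiv.swap a i j), ?_, by simp⟩
  have : a ≠ Equiv.swap a i j := fun h => hij (by simpa using congrArg (Equiv.swap a i) h)
  simp [Equiv.swap_apply_of_ne_of_ne hab this]

lemma exists_pairSum_ofFn_perm_sub {R : Type*} [Ring R] {n : ℕ} (hn : 2 ≤ n) (M : Fin n → R)
    {i j : Fin n} (hij : i ≠ j) :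
    ∃ σ τ : Equiv.Perm (Fin n),
      (List.ofFn fun k => M (σ k)).pairSum - (List.ofFn fun k => M (τ k)).pairSum =
        M i * M j - M j * M i := by
  obtain ⟨m, rfl⟩ := Nat.exists_eq_add_of_le' hn
  obtain ⟨σ, hi, hj⟩ := exists_perm_apply_eq (a := (0 : Fin (m + 2))) (b := 1) (by simp) hij
  refine ⟨σ, σ * Equiv.swap 0 1, ?_⟩
  have hk (k : Fin m) : Equiv.swap (0 : Fin (m + 2)) 1 k.succ.succ = k.succ.succ :=
    Equiv.swap_apply_of_ne_of_ne (Fin.succ_ne_zero _)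
      (fun h => Fin.succ_ne_zero k (Fin.succ_injective _ h))
  simp only [List.ofFn_succ, Fin.succ_zero_eq_one, Equiv.Perm.mul_apply, Equiv.swap_apply_left,
    Equiv.swap_apply_right, hk, hi, hj, List.pairSum_cons_cons_sub]

lemma exists_mulVec_commutator_ne_zero {n d : ℕ} {M : Fin n → Matrix (Fin d) (Fin d) ℝ}
    (hneg : (-(∑ i : Fin n, ∑ j : Fin n,
        if i ≠ j then (M i * M j - M j * M i) ^ 2 else 0)).PosDef)
    {x : Fin d → ℝ} (hx : x ≠ 0) :
    ∃ i j, i ≠ j ∧ (M i * M j - M j * M i) *ᵥ x ≠ 0 := by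
  by_contra! h
  refine (hneg.dotProduct_mulVec_pos hx).ne' ?_
  rw [neg_mulVec, sum_mulVec, Finset.sum_eq_zero, neg_zero, dotProduct_zero]
  intro i _
  rw [sum_mulVec]
  refine Finset.sum_eq_zero fun j _ => ?_
  split_ifs with hij
  · rw [sq, ← mulVec_mulVec, h i j hij, mulVec_zero]
  · exact zero_mulVec x

section Deviation

variable {n : ℕ} {V : Type*} [AddCommGroup V] [Module ℝ V]

/-- The deviation of `f σ` from the mean of `f` over all permutations. -/
noncomputable def permDev (f : Equiv.Perm (Fin n) → V) (σ : Equiv.Perm (Fin n)) : V :=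
  f σ - ((n.factorial : ℝ)⁻¹) • ∑ τ, f τ

lemma inv_factorial_smul_sum_const (v : V) :
    ((n.factorial : ℝ)⁻¹) • ∑ _τ : Equiv.Perm (Fin n), v = v := by
  rw [Finset.sum_const, Finset.card_univ, Fintype.card_perm, Fintype.card_fin,
    ← Nat.cast_smul_eq_nsmul ℝ, inv_smul_smul₀ (by positivity)]

lemma sum_permDev (f : Equiv.Perm (Fin n) → V) : ∑ σ, permDev f σ = 0 := by
  simp only [permDev, Finset.sum_sub_distrib]
  rw [← Finset.smul_sum, inv_factorial_smul_sum_const, sub_self]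

end Deviation

lemma permProd_one_sub_smul_eq_prod_map {n d : ℕ} (M : Fin n → Matrix (Fin d) (Fin d) ℝ) (η : ℝ)
    (σ : Equiv.Perm (Fin n)) :
    permProd (fun i => 1 - η • M i) σ =
      ((List.ofFn fun k => M (σ k)).map fun a => 1 - η • a).prod := by
  rw [permProd, List.map_ofFn]
  rfl

lemma exists_WSS_eq_WRS_add {n d : ℕ} (M : Fin n → Matrix (Fin d) (Fin d) ℝ) (K : ℕ) :
    ∃ H : ℝ → Matrix (Fin d) (Fin d) ℝ, Continuous H ∧
      (H 0 = ((n.factorial : ℝ)⁻¹) • ∑ σ, (K.choose 2 : ℝ) •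
        (permDev (fun τ : Equiv.Perm (Fin n) => (List.ofFn fun k => M (τ k)).pairSum) σ *
          permDev (fun τ : Equiv.Perm (Fin n) => (List.ofFn fun k => M (τ k)).pairSum) σ)) ∧
      ∀ η : ℝ, WSS n K (fun i => 1 - η • M i) =
        WRS n K (fun i => 1 - η • M i) + η ^ 4 • H η := by
  choose r hr hr0 hprod using fun σ : Equiv.Perm (Fin n) =>
    (List.ofFn fun k => M (σ k)).exists_prod_one_sub_smul_expansion
  obtain ⟨L, Q, -, hQ, -, hQ1, hpow⟩ :=
    exists_add_smul_pow_expansion (R := Matrix (Fin d) (Fin d) ℝ) K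
  have hperm (σ : Equiv.Perm (Fin n)) (η : ℝ) : permProd (fun i => 1 - η • M i) σ =
      1 - η • ∑ i, M i + η ^ 2 • r σ η := by
    rw [permProd_one_sub_smul_eq_prod_map, hprod, List.sum_ofFn, Equiv.sum_comp σ M]
  set P : ℝ → Matrix (Fin d) (Fin d) ℝ := fun η =>
    ((n.factorial : ℝ)⁻¹) • ∑ σ, permProd (fun i => 1 - η • M i) σ with hP
  have hPexp (η : ℝ) : P η = 1 - η • ∑ i, M i + η ^ 2 • ((n.factorial : ℝ)⁻¹) • ∑ σ, r σ η := by
    simp only [hP, hperm]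
    rw [Finset.sum_add_distrib, smul_add, inv_factorial_smul_sum_const, ← Finset.smul_sum,
      smul_comm]
  have hdev (σ : Equiv.Perm (Fin n)) (η : ℝ) : permProd (fun i => 1 - η • M i) σ =
      P η + η ^ 2 • permDev (fun τ => r τ η) σ := by
    rw [hperm, hPexp, permDev]
    module
  have hPc : Continuous P := by
    rw [funext hPexp]
    fun_prop
  refine ⟨fun η => ((n.factorial : ℝ)⁻¹) • ∑ σ, Q (P η) (permDev (fun τ => r τ η) σ) (η ^ 2),
    ?_, ?_, fun η => ?_⟩
  · have hGc (σ : Equiv.Perm (Fin n)) : Continuous fun η => permDev (fun τ => r τ η) σ := by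
      unfold permDev
      fun_prop
    have hQc (σ : Equiv.Perm (Fin n)) :
        Continuous fun η => Q (P η) (permDev (fun τ => r τ η) σ) (η ^ 2) :=
      hQ.comp (hPc.prodMk ((hGc σ).prodMk (continuous_pow 2)))
    fun_prop
  · have hP0 : P 0 = 1 := by simp [hPexp]
    simp [hP0, hr0, hQ1]
  · have hL0 : ∑ σ, L (P η) (permDev (fun τ => r τ η) σ) = 0 := by
      rw [← map_sum, sum_permDev, map_zero]
    have hWRS : WRS n K (fun i => 1 - η • M i) = P η ^ K := rfl
    rw [hWRS]
    simp only [WSS, hdev _ η, hpow]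
    rw [Finset.sum_add_distrib, Finset.sum_add_distrib, ← Finset.smul_sum, hL0,
      ← Finset.smul_sum, smul_zero, add_zero, smul_add, inv_factorial_smul_sum_const]
    module

lemma permDev_pairSum_transpose {n d : ℕ} {M : Fin n → Matrix (Fin d) (Fin d) ℝ}
    (hsymm : ∀ i, (M i).IsSymm) (σ : Equiv.Perm (Fin n)) :
    (permDev (fun τ : Equiv.Perm (Fin n) => (List.ofFn fun k => M (τ k)).pairSum) σ)ᵀ =
      -permDev (fun τ : Equiv.Perm (Fin n) => (List.ofFn fun k => M (τ k)).pairSum) σ := by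
  have h (τ : Equiv.Perm (Fin n)) : (List.ofFn fun k => M (τ k)).pairSumᵀ =
      ((∑ i, M i) * ∑ i, M i) - ∑ i, M i * M i - (List.ofFn fun k => M (τ k)).pairSum := by
    rw [eq_sub_iff_add_eq', List.pairSum_add_transpose _ (by simp [hsymm]), List.map_ofFn,
      List.sum_ofFn, List.sum_ofFn, Equiv.sum_comp τ M, ← Equiv.sum_comp τ fun i => M i * M i]
    rfl
  simp only [permDev, transpose_sub, transpose_smul, transpose_sum, h]
  rw [Finset.sum_sub_distrib, smul_sub, inv_factorial_smul_sum_const]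
  abel

lemma sum_dotProduct_permDev_sq_neg {n d : ℕ} (hn : 2 ≤ n)
    {M : Fin n → Matrix (Fin d) (Fin d) ℝ} (hsymm : ∀ i, (M i).IsSymm)
    (hneg : (-(∑ i : Fin n, ∑ j : Fin n,
        if i ≠ j then (M i * M j - M j * M i) ^ 2 else 0)).PosDef)
    {x : Fin d → ℝ} (hx : x ≠ 0) :
    ∑ σ, x ⬝ᵥ
      (permDev (fun τ : Equiv.Perm (Fin n) => (List.ofFn fun k => M (τ k)).pairSum) σ *
        permDev (fun τ : Equiv.Perm (Fin n) => (List.ofFn fun k => M (τ k)).pairSum) σ) *ᵥ x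
      < 0 := by
  set G := permDev fun τ : Equiv.Perm (Fin n) => (List.ofFn fun k => M (τ k)).pairSum with hG
  have hquad (σ) : x ⬝ᵥ (G σ * G σ) *ᵥ x = -((G σ *ᵥ x) ⬝ᵥ (G σ *ᵥ x)) := by
    rw [← mulVec_mulVec, dotProduct_mulVec, ← mulVec_transpose,
      permDev_pairSum_transpose hsymm σ, neg_mulVec, neg_dotProduct]
  have hnonneg (σ) : 0 ≤ (G σ *ᵥ x) ⬝ᵥ (G σ *ᵥ x) := by
    simpa using dotProduct_star_self_nonneg (G σ *ᵥ x)
  refine Finset.sum_neg' (fun σ _ => by rw [hquad]; exact neg_nonpos.mpr (hnonneg σ)) ?_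
  obtain ⟨i, j, hij, hne⟩ := exists_mulVec_commutator_ne_zero hneg hx
  obtain ⟨σ, τ, hστ⟩ := exists_pairSum_ofFn_perm_sub hn M hij
  have hsub : G σ - G τ = M i * M j - M j * M i := by
    rw [← hστ, hG, permDev, permDev]
    abel
  by_contra! hall
  have hzero (ρ) : G ρ *ᵥ x = 0 := by
    have := hall ρ (Finset.mem_univ ρ)
    rw [hquad] at this
    exact dotProduct_self_eq_zero.mp (le_antisymm (by linarith) (hnonneg ρ))
  exact hne (by rw [← hsub, sub_mulVec, hzero, hzero, sub_zero])

/-- If the sum of squared commutators of symmetric matrices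
`M_1,…,M_n` (n ≥ 2) over ordered pairs of distinct indices is negative definite, then for every
K ≥ 1 there is η_max ∈ (0,1] such that for all η ∈ [0,η_max], with A_i = I - η M_i we have
‖W_SS‖ ≤ ‖W_RS‖. -/
theorem statement0 (n d : ℕ) (hn : 2 ≤ n) (M : Fin n → Matrix (Fin d) (Fin d) ℝ)
    (hsymm : ∀ i, (M i).IsSymm)
    (hneg : (-(∑ i : Fin n, ∑ j : Fin n,
        if i ≠ j then (M i * M j - M j * M i) ^ 2 else 0)).PosDef) :
    ∀ K : ℕ, 1 ≤ K → ∃ ηmax : ℝ, ηmax ∈ Set.Ioc (0 : ℝ) 1 ∧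
      ∀ η ∈ Set.Icc (0 : ℝ) ηmax,
        specNorm (WSS n K (fun i => 1 - η • M i)) ≤
          specNorm (WRS n K (fun i => 1 - η • M i)) := by
  intro K hK
  rcases hK.eq_or_lt with rfl | hK
  · exact ⟨1, by simp, fun η _ => by simp [WSS, WRS]⟩
  have hev : ∀ᶠ η in 𝓝 (0 : ℝ), specNorm (WSS n K (fun i => 1 - η • M i)) ≤
      specNorm (WRS n K (fun i => 1 - η • M i)) := by
    obtain ⟨H, hH, hH0, hexp⟩ := exists_WSS_eq_WRS_add M K
    have hW : Continuous fun η : ℝ => WRS n K (fun i => 1 - η • M i) := by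
      unfold WRS
      simp only [permProd_one_sub_smul_eq_prod_map]
      fun_prop
    have hW0 : WRS n K (fun i => 1 - (0 : ℝ) • M i) = 1 := by
      simp only [WRS, permProd, zero_smul, sub_zero, List.ofFn_const, List.prod_replicate, one_pow,
        inv_factorial_smul_sum_const]
    have hN : Continuous fun η : ℝ =>
        (2 : ℝ) • ((WRS n K (fun i => 1 - η • M i))ᵀ * H η) + η ^ 4 • ((H η)ᵀ * H η) := by
      fun_prop
    refine (eventually_forall_dotProduct_mulVec_nonpos hN fun x hx => ?_).mono fun η hη => ?_
    · have hG := sum_dotProduct_permDev_sq_neg hn hsymm hneg hx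
      have hc : (0 : ℝ) < K.choose 2 := by exact_mod_cast Nat.choose_pos hK
      simp only [hW0, transpose_one, one_mul, hH0, ← Finset.smul_sum, smul_mulVec, sum_mulVec,
        dotProduct_smul, dotProduct_sum, smul_eq_mul, add_mulVec, dotProduct_add, ne_eq,
        OfNat.ofNat_ne_zero, not_false_eq_true, zero_pow, zero_mul, add_zero]
      exact mul_neg_of_pos_of_neg two_pos (mul_neg_of_pos_of_neg (by positivity)
        (mul_neg_of_pos_of_neg hc hG))
    · rw [hexp]
      exact specNorm_add_smul_le (by positivity) hη
  obtain ⟨ε, hε, h⟩ := Metric.eventually_nhds_iff.mp hev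
  refine ⟨min (ε / 2) 1, ⟨by positivity, min_le_right _ _⟩, fun η hη => h ?_⟩
  rw [Real.dist_eq, sub_zero, abs_of_nonneg hη.1]
  linarith [hη.2.trans (min_le_left _ _)]
end

section
/- Let n ≥ 2, K ≥ 1, and d ≤ n. Suppose x_1, …, x_n ∈ ℝ^d are unit vectors satisfying: (A1) |x_i^T x_j| ≤ n^{−1/2} for all i ≠ j; and (A2) n^{−1/4} ≤ Σ_{i=1}^n (u^T x_i)^2 ≤ n^{1/4} for every unit vector u ∈ ℝ^d. Then for every η ∈ [0, 1/(6n)], the matrices A_i := I − η x_i x_i^T satisfy ‖W_RS(n,K,A_1,…,A_n)‖ ≤ ‖W_GD(n,K,A_1,…,A_n)‖. -/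
section GradientSteps

open scoped RealInnerProductSpace

variable {E : Type*} [NormedAddCommGroup E] [InnerProductSpace ℝ E]

/-- The gradient step `1 - η x xᵀ` of the least-squares loss at the data point `x`. -/
noncomputable def gradStep (η : ℝ) (x : E) : E →L[ℝ] E :=
  1 - η • InnerProductSpace.rankOne ℝ x x

theorem gradStep_apply (η : ℝ) (x u : E) : gradStep η x u = u - (η * ⟪x, u⟫) • x := by
  simp [gradStep, smul_smul]

theorem inner_gradStep (η : ℝ) (x u v : E) :
    ⟪v, gradStep η x u⟫ = ⟪v, u⟫ - η * ⟪x, u⟫ * ⟪v, x⟫ := by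
  rw [gradStep_apply, inner_sub_right, inner_smul_right]

theorem inner_gradStep_comm (η : ℝ) (x u v : E) :
    ⟪gradStep η x u, v⟫ = ⟪u, gradStep η x v⟫ := by
  rw [real_inner_comm, inner_gradStep, inner_gradStep, real_inner_comm u v, real_inner_comm x u,
    real_inner_comm v x]
  ring

/-- The ordered product of the gradient steps at the points of a list. -/
noncomputable def gradProd (η : ℝ) (L : List E) : E →L[ℝ] E :=
  (L.map (gradStep η)).prod

theorem gradProd_nil (η : ℝ) : gradProd η ([] : List E) = 1 := rfl

theorem gradProd_cons (η : ℝ) (x : E) (L : List E) :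
    gradProd η (x :: L) = gradStep η x * gradProd η L := by
  simp [gradProd]

theorem gradProd_append_singleton (η : ℝ) (x : E) (L : List E) :
    gradProd η (L ++ [x]) = gradProd η L * gradStep η x := by
  simp [gradProd]

theorem inner_gradProd_cons (η : ℝ) (x : E) (L : List E) (u v : E) :
    ⟪v, gradProd η (x :: L) u⟫
      = ⟪v, gradProd η L u⟫ - η * ⟪x, gradProd η L u⟫ * ⟪v, x⟫ := by
  rw [gradProd_cons, mul_apply_eq_comp, inner_gradStep]

theorem inner_gradProd_reverse (η : ℝ) (L : List E) :
    ∀ u v : E, ⟪gradProd η L u, v⟫ = ⟪u, gradProd η L.reverse v⟫ := by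
  induction L with
  | nil => intro u v; simp [gradProd_nil]
  | cons x L ih =>
    intro u v
    rw [List.reverse_cons, gradProd_append_singleton, gradProd_cons,
      mul_apply_eq_comp, mul_apply_eq_comp, inner_gradStep_comm, ih]

/-- The sum of the absolute residuals `|⟪x, u⟫|` seen by the successive steps of `gradProd`. -/
noncomputable def residualSum (η : ℝ) (u : E) : List E → ℝ
  | [] => 0
  | x :: L => |⟪x, gradProd η L u⟫| + residualSum η u L

theorem residualSum_nonneg (η : ℝ) (u : E) (L : List E) : 0 ≤ residualSum η u L := by
  induction L with
  | nil => exact le_rfl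
  | cons x L ih => exact add_nonneg (abs_nonneg _) ih

theorem abs_inner_gradProd_sub_le {η r : ℝ} (hη : 0 ≤ η) (x u : E) (L : List E)
    (hL : ∀ l ∈ L, |⟪x, l⟫| ≤ r) :
    |⟪x, gradProd η L u⟫ - ⟪x, u⟫| ≤ η * r * residualSum η u L := by
  induction L with
  | nil => simp [gradProd_nil, residualSum]
  | cons z L ih =>
    have hz := hL z (by simp)
    have ih := ih fun l hl => hL l (by simp [hl])
    have h : |η * ⟪z, gradProd η L u⟫ * ⟪x, z⟫| ≤ η * r * |⟪z, gradProd η L u⟫| := by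
      rw [abs_mul, abs_mul, abs_of_nonneg hη]
      nlinarith [mul_le_mul_of_nonneg_left hz (mul_nonneg hη (abs_nonneg ⟪z, gradProd η L u⟫))]
    rw [inner_gradProd_cons, residualSum]
    rw [abs_le] at *
    constructor <;> nlinarith

theorem residualSum_mul_le {η r : ℝ} (hη : 0 ≤ η) (hr : 0 ≤ r) (u : E) (L : List E)
    (hL : L.Pairwise fun x y => |⟪x, y⟫| ≤ r) :
    residualSum η u L * (1 - η * r * L.length) ≤ (L.map fun x => |⟪x, u⟫|).sum := by
  induction L with
  | nil => simp [residualSum]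
  | cons x L ih =>
    rw [List.pairwise_cons] at hL
    have ih := ih hL.2
    have h := abs_inner_gradProd_sub_le hη x u L hL.1
    have hY := residualSum_nonneg η u L
    have hh : 0 ≤ η * r := mul_nonneg hη hr
    have hx : |⟪x, gradProd η L u⟫| ≤ |⟪x, u⟫| + η * r * residualSum η u L := by
      linarith [abs_sub_abs_le_abs_sub ⟪x, gradProd η L u⟫ ⟪x, u⟫]
    have hl : (0 : ℝ) ≤ L.length := Nat.cast_nonneg _
    simp only [residualSum, List.map_cons, List.sum_cons, List.length_cons, Nat.cast_add,
      Nat.cast_one]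
    set m : ℝ := (L.length : ℝ)
    set h' := η * r
    set Y := residualSum η u L
    by_cases hp : 0 ≤ 1 - h' * (m + 1)
    · have h1 := mul_le_mul_of_nonneg_right hx hp
      have h2 : 0 ≤ |⟪x, u⟫| * (h' * (m + 1)) := by positivity
      have h3 : 0 ≤ Y * (h' * h' * (m + 1)) := by positivity
      nlinarith
    · have h4 : (|⟪x, gradProd η L u⟫| + Y) * (1 - h' * (m + 1)) ≤ 0 :=
        mul_nonpos_of_nonneg_of_nonpos (by positivity) (by linarith)
      have h5 : 0 ≤ (L.map fun x => |⟪x, u⟫|).sum :=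
        List.sum_nonneg (by simp)
      linarith [abs_nonneg ⟪x, u⟫]

/-- `∑ ⟪x, u⟫ x`: the (uncentred) covariance of the data applied to `u`. -/
noncomputable def covSum (u : E) (L : List E) : E := (L.map fun x => ⟪x, u⟫ • x).sum

theorem abs_inner_gradProd_sub_covSum_le {η r : ℝ} (hη : 0 ≤ η) (hr : 0 ≤ r) (x u : E)
    (L : List E) (hx : ∀ l ∈ L, |⟪x, l⟫| ≤ r) (hL : L.Pairwise fun x y => |⟪x, y⟫| ≤ r) :
    |⟪x, gradProd η L u⟫ - (⟪x, u⟫ - η * ⟪x, covSum u L⟫)|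
      ≤ (η * r) ^ 2 * L.length * residualSum η u L := by
  induction L with
  | nil => simp [gradProd_nil, covSum, residualSum]
  | cons z L ih =>
    rw [List.pairwise_cons] at hL
    have hz := hx z (by simp)
    have ih := ih (fun l hl => hx l (by simp [hl])) hL.2
    have h := abs_inner_gradProd_sub_le hη z u L hL.1
    have hY := residualSum_nonneg η u L
    have hh : 0 ≤ η * r := mul_nonneg hη hr
    have e : ⟪x, gradProd η (z :: L) u⟫ - (⟪x, u⟫ - η * ⟪x, covSum u (z :: L)⟫)
        = (⟪x, gradProd η L u⟫ - (⟪x, u⟫ - η * ⟪x, covSum u L⟫))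
          - η * ⟪x, z⟫ * (⟪z, gradProd η L u⟫ - ⟪z, u⟫) := by
      rw [inner_gradProd_cons]
      simp only [covSum, List.map_cons, List.sum_cons, inner_add_right, inner_smul_right]
      ring
    have h2 : |η * ⟪x, z⟫ * (⟪z, gradProd η L u⟫ - ⟪z, u⟫)|
        ≤ η * r * (η * r * residualSum η u L) := by
      rw [abs_mul, abs_mul, abs_of_nonneg hη]
      exact mul_le_mul (mul_le_mul_of_nonneg_left hz hη) h (abs_nonneg _) hh
    have h3 : 0 ≤ (η * r) ^ 2 * (L.length + 1) * |⟪z, gradProd η L u⟫| := by positivity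
    rw [e]
    refine (abs_sub _ _).trans ?_
    simp only [residualSum, List.length_cons, Nat.cast_add, Nat.cast_one]
    nlinarith

theorem abs_quadratic_gradProd_sub_le {η r : ℝ} (hη : 0 ≤ η) (hr : 0 ≤ r) (u : E)
    (L : List E) (h1 : ∀ l ∈ L, ‖l‖ = 1) (hL : L.Pairwise fun x y => |⟪x, y⟫| ≤ r) :
    |⟪u, gradProd η L u⟫ - (‖u‖ ^ 2 - η * (L.map fun x => ⟪x, u⟫ ^ 2).sum
        + η ^ 2 / 2 * (‖covSum u L‖ ^ 2 - (L.map fun x => ⟪x, u⟫ ^ 2).sum))|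
      ≤ η * (η * r) ^ 2 * (L.length - 1) * (L.map fun x => |⟪x, u⟫|).sum
        * residualSum η u L := by
  induction L with
  | nil => simp [gradProd_nil, covSum, residualSum]
  | cons x L ih =>
    rw [List.pairwise_cons] at hL
    have ih := ih (fun l hl => h1 l (by simp [hl])) hL.2
    have h := abs_inner_gradProd_sub_covSum_le hη hr x u L hL.1 hL.2
    have hY := residualSum_nonneg η u L
    have hA : 0 ≤ (L.map fun x => |⟪x, u⟫|).sum := List.sum_nonneg (by simp)
    have hx : ‖x‖ = 1 := h1 x (by simp)
    have hw : ‖covSum u (x :: L)‖ ^ 2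
        = ⟪x, u⟫ ^ 2 + 2 * ⟪x, u⟫ * ⟪x, covSum u L⟫ + ‖covSum u L‖ ^ 2 := by
      have : covSum u (x :: L) = ⟪x, u⟫ • x + covSum u L := by simp [covSum]
      rw [this, norm_add_sq_real, norm_smul, hx, real_inner_smul_left, Real.norm_eq_abs, mul_one,
        sq_abs]
      ring
    have h2 : |η * ⟪x, u⟫ * (⟪x, gradProd η L u⟫ - (⟪x, u⟫ - η * ⟪x, covSum u L⟫))|
        ≤ η * |⟪x, u⟫| * ((η * r) ^ 2 * L.length * residualSum η u L) := by
      rw [abs_mul, abs_mul, abs_of_nonneg hη]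
      exact mul_le_mul_of_nonneg_left h (by positivity)
    rw [inner_gradProd_cons, hw, real_inner_comm x u]
    simp only [residualSum, List.map_cons, List.sum_cons, List.length_cons, Nat.cast_add,
      Nat.cast_one]
    have h3 : 0 ≤ η * (η * r) ^ 2 * L.length * (|⟪x, u⟫| + (L.map fun x => |⟪x, u⟫|).sum)
        * |⟪x, gradProd η L u⟫| := by positivity
    have h4 : 0 ≤ η * (η * r) ^ 2 * (L.map fun x => |⟪x, u⟫|).sum * residualSum η u L := by
      positivity
    generalize (L.map fun x => |⟪x, u⟫|).sum = A at *
    generalize (L.map fun x => ⟪x, u⟫ ^ 2).sum = s at *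
    rw [abs_le] at ih h2 ⊢
    constructor <;> nlinarith

theorem abs_quadratic_gradProd_ofFn_sub_le {n : ℕ} {η r : ℝ} (hη : 0 ≤ η)
    (hηn : η * n ≤ 1 / 6) (hr : 0 ≤ r) (hr1 : r ≤ 1) (hrn : r ^ 2 * n = 1) (x : Fin n → E)
    (h1 : ∀ i, ‖x i‖ = 1) (hx : ∀ i j, i ≠ j → |⟪x i, x j⟫| ≤ r) (u : E) :
    |⟪u, gradProd η (List.ofFn x) u⟫ - (‖u‖ ^ 2 - η * ∑ i, ⟪x i, u⟫ ^ 2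
        + η ^ 2 / 2 * (‖∑ i, ⟪x i, u⟫ • x i‖ ^ 2 - ∑ i, ⟪x i, u⟫ ^ 2))|
      ≤ η ^ 2 * ((1 - r ^ 2) / 5) * ∑ i, ⟪x i, u⟫ ^ 2 := by
  have hL : (List.ofFn x).Pairwise fun y z => |⟪y, z⟫| ≤ r :=
    List.pairwise_ofFn.2 fun i j hij => hx i j hij.ne
  have h := abs_quadratic_gradProd_sub_le hη hr u (List.ofFn x)
    (by simpa [List.mem_ofFn] using h1) hL
  have hY := residualSum_mul_le hη hr u (List.ofFn x) hL
  have hA : (∑ i, |⟪x i, u⟫|) ^ 2 ≤ n * ∑ i, ⟪x i, u⟫ ^ 2 := by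
    simpa using sq_sum_le_card_mul_sum_sq (s := Finset.univ) (f := fun i => |⟪x i, u⟫|)
  simp only [covSum, List.map_ofFn, List.sum_ofFn, List.length_ofFn, Function.comp_def]
    at h hY
  refine h.trans ?_
  have hA0 : 0 ≤ ∑ i, |⟪x i, u⟫| := Finset.sum_nonneg fun _ _ => abs_nonneg _
  have hY0 := residualSum_nonneg η u (List.ofFn x)
  have hs0 : 0 ≤ ∑ i, ⟪x i, u⟫ ^ 2 := Finset.sum_nonneg fun _ _ => sq_nonneg _
  have hr2 : 0 ≤ 1 - r ^ 2 := by nlinarith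
  have hn0 : (0 : ℝ) ≤ n := n.cast_nonneg
  generalize residualSum η u (List.ofFn x) = Y at *
  generalize ∑ i, |⟪x i, u⟫| = A at *
  generalize ∑ i, ⟪x i, u⟫ ^ 2 = s at *
  have hYA : Y ≤ 6 / 5 * A := by
    have : η * r * n ≤ 1 / 6 := by nlinarith [mul_nonneg hη hn0]
    nlinarith
  calc η * (η * r) ^ 2 * (n - 1) * A * Y
      = η ^ 3 * (r ^ 2 * n - r ^ 2) * (A * Y) := by ring
    _ = η ^ 3 * (1 - r ^ 2) * (A * Y) := by rw [hrn]
    _ ≤ η ^ 3 * (1 - r ^ 2) * (6 / 5 * (n * s)) := by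
        refine mul_le_mul_of_nonneg_left ?_ (by positivity)
        nlinarith [mul_le_mul_of_nonneg_left hYA hA0]
    _ = (η * n) * (6 / 5 * η ^ 2 * (1 - r ^ 2) * s) := by ring
    _ ≤ 1 / 6 * (6 / 5 * η ^ 2 * (1 - r ^ 2) * s) :=
        mul_le_mul_of_nonneg_right hηn (by positivity)
    _ = _ := by ring

/-- The average of the products of the gradient steps over all orders of the data points. -/
noncomputable def reshuffleMean {n : ℕ} (η : ℝ) (x : Fin n → E) : E →L[ℝ] E :=
  (n.factorial : ℝ)⁻¹ • ∑ σ : Equiv.Perm (Fin n), gradProd η (List.ofFn fun i => x (σ i))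

theorem inner_reshuffleMean_comm {n : ℕ} (η : ℝ) (x : Fin n → E) (u v : E) :
    ⟪reshuffleMean η x u, v⟫ = ⟪u, reshuffleMean η x v⟫ := by
  have hrev (σ : Equiv.Perm (Fin n)) :
      (List.ofFn fun i => x (σ i)).reverse = List.ofFn fun i => x ((σ * Fin.revPerm : Equiv.Perm (Fin n)) i) := by
    refine List.ext_getElem (by simp) fun i h1 h2 => ?_
    simp only [List.length_reverse, List.length_ofFn] at h1
    simp only [List.getElem_reverse, List.getElem_ofFn, List.length_ofFn, Equiv.Perm.mul_apply,
      Fin.revPerm_apply]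
    congr 2
    ext
    simp only [Fin.val_rev]
    omega
  simp only [reshuffleMean, smul_apply, sum_apply,
    real_inner_smul_left, real_inner_smul_right, sum_inner, inner_sum, inner_gradProd_reverse,
    hrev]
  congr 1
  exact Equiv.sum_comp (Equiv.mulRight Fin.revPerm)
    fun σ => ⟪u, gradProd η (List.ofFn fun i => x (σ i)) v⟫

theorem abs_quadratic_reshuffleMean_sub_le {n : ℕ} {η r : ℝ} (hη : 0 ≤ η)
    (hηn : η * n ≤ 1 / 6) (hr : 0 ≤ r) (hr1 : r ≤ 1) (hrn : r ^ 2 * n = 1) (x : Fin n → E)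
    (h1 : ∀ i, ‖x i‖ = 1) (hx : ∀ i j, i ≠ j → |⟪x i, x j⟫| ≤ r) (u : E) :
    |⟪u, reshuffleMean η x u⟫ - (‖u‖ ^ 2 - η * ∑ i, ⟪x i, u⟫ ^ 2
        + η ^ 2 / 2 * (‖∑ i, ⟪x i, u⟫ • x i‖ ^ 2 - ∑ i, ⟪x i, u⟫ ^ 2))|
      ≤ η ^ 2 * ((1 - r ^ 2) / 5) * ∑ i, ⟪x i, u⟫ ^ 2 := by
  have key (σ : Equiv.Perm (Fin n)) := abs_quadratic_gradProd_ofFn_sub_le hη hηn hr hr1 hrn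
    (fun i => x (σ i)) (fun i => h1 _) (fun i j hij => hx _ _ (σ.injective.ne hij)) u
  have e1 (σ : Equiv.Perm (Fin n)) : ∑ i, ⟪x (σ i), u⟫ ^ 2 = ∑ i, ⟪x i, u⟫ ^ 2 :=
    Equiv.sum_comp σ fun i => ⟪x i, u⟫ ^ 2
  have e2 (σ : Equiv.Perm (Fin n)) :
      ∑ i, ⟪x (σ i), u⟫ • x (σ i) = ∑ i, ⟪x i, u⟫ • x i :=
    Equiv.sum_comp σ fun i => ⟪x i, u⟫ • x i
  simp only [e1, e2] at key
  generalize ‖u‖ ^ 2 - η * ∑ i, ⟪x i, u⟫ ^ 2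
    + η ^ 2 / 2 * (‖∑ i, ⟪x i, u⟫ • x i‖ ^ 2 - ∑ i, ⟪x i, u⟫ ^ 2) = c at *
  generalize η ^ 2 * ((1 - r ^ 2) / 5) * ∑ i, ⟪x i, u⟫ ^ 2 = b at *
  have hf : (n.factorial : ℝ) ≠ 0 := by exact_mod_cast n.factorial_ne_zero
  have e3 : ⟪u, reshuffleMean η x u⟫ - c = (n.factorial : ℝ)⁻¹ *
      ∑ σ : Equiv.Perm (Fin n), (⟪u, gradProd η (List.ofFn fun i => x (σ i)) u⟫ - c) := by
    simp only [reshuffleMean, smul_apply, sum_apply,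
      real_inner_smul_right, inner_sum, Finset.sum_sub_distrib, Finset.sum_const,
      Finset.card_univ, Fintype.card_perm, Fintype.card_fin, nsmul_eq_mul]
    field_simp
  rw [e3, abs_mul, abs_of_nonneg (by positivity), inv_mul_le_iff₀ (by positivity)]
  calc _ ≤ ∑ σ : Equiv.Perm (Fin n),
        |⟪u, gradProd η (List.ofFn fun i => x (σ i)) u⟫ - c| := Finset.abs_sum_le_sum_abs _ _
    _ ≤ ∑ σ : Equiv.Perm (Fin n), b := Finset.sum_le_sum fun σ _ => key σ
    _ = _ := by simp [Fintype.card_perm]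

end GradientSteps

theorem IsSelfAdjoint.norm_pow_eq {A : Type*} [NormedRing A] [NormOneClass A] [StarRing A]
    [CStarRing A] {a : A} (ha : IsSelfAdjoint a) (m : ℕ) : ‖a ^ m‖ = ‖a‖ ^ m := by
  refine le_antisymm (norm_pow_le a m) ?_
  rcases (norm_nonneg a).eq_or_lt with h0 | h0
  · rw [← h0]
    rcases m.eq_zero_or_pos with rfl | hm
    · simp
    · simp [hm.ne']
  · have hm : m ≤ 2 ^ m := Nat.lt_two_pow_self.le
    have h : ‖a‖ ^ m * ‖a‖ ^ (2 ^ m - m) ≤ ‖a ^ m‖ * ‖a‖ ^ (2 ^ m - m) := by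
      rw [← pow_add, Nat.add_sub_cancel' hm, ← ha.norm_pow_two_pow]
      calc ‖a ^ 2 ^ m‖ = ‖a ^ m * a ^ (2 ^ m - m)‖ := by
            rw [← pow_add, Nat.add_sub_cancel' hm]
        _ ≤ ‖a ^ m‖ * ‖a ^ (2 ^ m - m)‖ := norm_mul_le _ _
        _ ≤ _ := mul_le_mul_of_nonneg_left (norm_pow_le _ _) (norm_nonneg _)
    exact le_of_mul_le_mul_right h (by positivity)

theorem cubic_le_one_sub_pow {y : ℝ} (h0 : 0 ≤ y) (h1 : y ≤ 1) (n : ℕ) :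
    1 - n * y + n * (n - 1) / 2 * y ^ 2 - n * (n - 1) * (n - 2) / 6 * y ^ 3 ≤ (1 - y) ^ n := by
  induction n with
  | zero => simp
  | succ n ih =>
    have h := mul_le_mul_of_nonneg_right ih (sub_nonneg.2 h1)
    have hn : (0 : ℝ) ≤ n * (n - 1) * (n - 2) := by
      rcases n with _ | _ | n
      · simp
      · simp
      · push_cast
        ring_nf
        positivity
    rw [pow_succ (1 - y)]
    push_cast
    nlinarith [mul_nonneg hn (pow_nonneg h0 4)]

theorem second_order_le_one_sub_pow {n : ℕ} (hn : 2 ≤ n) {η r l : ℝ} (hη : 0 ≤ η)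
    (hηn : η * n ≤ 1 / 6) (hrn : r ^ 2 * n = 1) (hl0 : 0 ≤ l) (hln : l ≤ 1 + (n - 1) / 4)
    (hl2 : l ^ 2 ≤ n) :
    1 - η * l + η ^ 2 * l ^ 2 / 2 - η ^ 2 * l * (1 / 2 - (1 - r ^ 2) / 5)
      ≤ (1 - η * l / n) ^ n := by
  have hn2 : (2 : ℝ) ≤ n := by exact_mod_cast hn
  have hn0 : (0 : ℝ) < n := by linarith
  have hr2 : r ^ 2 = 1 / n := by
    rw [eq_div_iff hn0.ne']
    exact hrn
  have hr2n : r ^ 2 ≤ 1 / 2 := by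
    rw [hr2]
    exact one_div_le_one_div_of_le two_pos hn2
  have hηl : η * l ≤ 1 / 6 :=
    (mul_le_mul_of_nonneg_left (by linarith : l ≤ n) hη).trans hηn
  have hy1 : η * l / n ≤ 1 := by
    rw [div_le_iff₀ hn0]
    linarith
  refine le_trans ?_ (cubic_le_one_sub_pow (by positivity) hy1 n)
  have e : 1 - n * (η * l / n) + n * (n - 1) / 2 * (η * l / n) ^ 2
      - n * (n - 1) * (n - 2) / 6 * (η * l / n) ^ 3
      = 1 - η * l + (1 - r ^ 2) / 2 * (η * l) ^ 2
        - (1 - r ^ 2) * (1 - 2 * r ^ 2) / 6 * (η * l) ^ 3 := by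
    rw [hr2]
    field_simp
  rw [e]
  have h2 : (1 - r ^ 2) * (1 - 2 * r ^ 2) * (η * l) ^ 3 ≤ 1 * (η * l) ^ 3 := by
    refine mul_le_mul_of_nonneg_right ?_ (by positivity)
    nlinarith [sq_nonneg r]
  have h3 : r ^ 2 * l ≤ 1 / 4 + 3 / 4 * r ^ 2 := by
    nlinarith [mul_le_mul_of_nonneg_left hln (sq_nonneg r)]
  have h4 : η * l ^ 2 ≤ 1 / 6 := (mul_le_mul_of_nonneg_left hl2 hη).trans hηn
  have h5 : 0 ≤ η ^ 2 * l * (1 / 2 - (1 - r ^ 2) / 5 - r ^ 2 * l / 2 - η * l ^ 2 / 6) :=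
    mul_nonneg (by positivity) (by linarith)
  linarith

section QuadraticForms

open scoped RealInnerProductSpace

variable {E : Type*} [NormedAddCommGroup E] [InnerProductSpace ℝ E]

theorem norm_sq_apply_le_of_quadratic_le {B : E →L[ℝ] E} (hB : ∀ u v, ⟪B u, v⟫ = ⟪u, B v⟫)
    {M : ℝ} (hM : 0 < M) (h0 : ∀ v, 0 ≤ ⟪v, B v⟫) (hBM : ∀ v, ⟪v, B v⟫ ≤ M * ‖v‖ ^ 2) (u : E) :
    ‖B u‖ ^ 2 ≤ M * ⟪u, B u⟫ := by
  have h := h0 (M • u - B u)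
  have h' := hBM (B u)
  simp only [map_sub, map_smul, inner_sub_left, inner_sub_right, real_inner_smul_left,
    real_inner_smul_right, ← hB u (B u), real_inner_self_eq_norm_sq] at h
  nlinarith

theorem opNorm_le_of_quadratic_le {B : E →L[ℝ] E} (hB : ∀ u v, ⟪B u, v⟫ = ⟪u, B v⟫)
    {M : ℝ} (hM : 0 < M) (h0 : ∀ v, 0 ≤ ⟪v, B v⟫) (hBM : ∀ v, ⟪v, B v⟫ ≤ M * ‖v‖ ^ 2) :
    ‖B‖ ≤ M := by
  refine B.opNorm_le_bound hM.le fun u => ?_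
  have h := norm_sq_apply_le_of_quadratic_le hB hM h0 hBM u
  refine le_of_sq_le_sq ?_ (by positivity)
  nlinarith [hBM u]

theorem isSelfAdjoint_gradMean [CompleteSpace E] {n : ℕ} (η : ℝ) (x : Fin n → E) :
    IsSelfAdjoint ((n : ℝ)⁻¹ • ∑ i, gradStep η (x i)) := by
  refine (ContinuousLinearMap.isSelfAdjoint_iff_isSymmetric).2 fun u v => ?_
  simp only [ContinuousLinearMap.coe_coe, smul_apply, sum_apply, real_inner_smul_left,
    real_inner_smul_right, sum_inner, inner_sum, inner_gradStep_comm]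

theorem quadratic_gradMean {n : ℕ} (hn : n ≠ 0) (η : ℝ) (x : Fin n → E) (u : E) :
    ⟪u, ((n : ℝ)⁻¹ • ∑ i, gradStep η (x i)) u⟫ = ‖u‖ ^ 2 - η / n * ∑ i, ⟪x i, u⟫ ^ 2 := by
  have hn' : (n : ℝ) ≠ 0 := Nat.cast_ne_zero.2 hn
  have e (i : Fin n) : η * ⟪x i, u⟫ * ⟪u, x i⟫ = η * ⟪x i, u⟫ ^ 2 := by
    rw [real_inner_comm (x i) u]
    ring
  simp only [smul_apply, sum_apply, real_inner_smul_right, inner_sum, inner_gradStep,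
    real_inner_self_eq_norm_sq, e, Finset.sum_sub_distrib, Finset.sum_const, Finset.card_univ,
    Fintype.card_fin, nsmul_eq_mul, ← Finset.mul_sum]
  field_simp

/-- If the covariance form has values in `[l * ‖u‖ ^ 2, M * ‖u‖ ^ 2]`, then its square is bounded
by the chord over that interval. -/
theorem norm_sq_cov_le {n : ℕ} (x : Fin n → E) {l M : ℝ} (hl : 0 ≤ l) (hM : 0 < M)
    (h0 : ∀ v : E, l * ‖v‖ ^ 2 ≤ ∑ i, ⟪x i, v⟫ ^ 2)
    (hSM : ∀ v : E, ∑ i, ⟪x i, v⟫ ^ 2 ≤ M * ‖v‖ ^ 2) (u : E) :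
    ‖∑ i, ⟪x i, u⟫ • x i‖ ^ 2
      ≤ (M + 2 * l) * (∑ i, ⟪x i, u⟫ ^ 2 - l * ‖u‖ ^ 2) + l ^ 2 * ‖u‖ ^ 2 := by
  set B : E →L[ℝ] E := ∑ i, InnerProductSpace.rankOne ℝ (x i) (x i) - l • 1
  have hBapp (v : E) : B v = ∑ i, ⟪x i, v⟫ • x i - l • v := by simp [B, sum_apply]
  have hcov (v : E) : ⟪v, ∑ i, ⟪x i, v⟫ • x i⟫ = ∑ i, ⟪x i, v⟫ ^ 2 := by
    rw [inner_sum]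
    refine Finset.sum_congr rfl fun i _ => ?_
    rw [real_inner_smul_right, real_inner_comm (x i) v]
    ring
  have hq (v : E) : ⟪v, B v⟫ = ∑ i, ⟪x i, v⟫ ^ 2 - l * ‖v‖ ^ 2 := by
    rw [hBapp, inner_sub_right, hcov, real_inner_smul_right, real_inner_self_eq_norm_sq]
  have hBs (v w : E) : ⟪B v, w⟫ = ⟪v, B w⟫ := by
    simp only [hBapp, inner_sub_left, inner_sub_right, sum_inner, inner_sum, real_inner_smul_left,
      real_inner_smul_right]
    congr 1
    refine Finset.sum_congr rfl fun i _ => ?_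
    rw [real_inner_comm (x i) v]
    ring
  have h := norm_sq_apply_le_of_quadratic_le hBs hM (fun v => by rw [hq]; linarith [h0 v])
    (fun v => by rw [hq]; nlinarith [hSM v, mul_nonneg hl (sq_nonneg ‖v‖)]) u
  rw [hq, hBapp, norm_sub_sq_real, real_inner_smul_right, real_inner_comm, hcov, norm_smul,
    Real.norm_eq_abs, mul_pow, sq_abs] at h
  linarith

theorem norm_reshuffleMean_le [FiniteDimensional ℝ E] [Nontrivial E] {n : ℕ} (hn : 2 ≤ n)
    {η r M : ℝ} (hη : 0 ≤ η) (hηn : η * n ≤ 1 / 6) (hr : 0 ≤ r) (hr1 : r ≤ 1)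
    (hrn : r ^ 2 * n = 1) (hM : 0 < M) (hMn : M ≤ 1 + (n - 1) / 4) (hM2 : M ^ 2 ≤ n)
    (x : Fin n → E) (h1 : ∀ i, ‖x i‖ = 1) (hx : ∀ i j, i ≠ j → |⟪x i, x j⟫| ≤ r)
    (hS : ∀ u : E, ‖u‖ = 1 → ∑ i, ⟪x i, u⟫ ^ 2 ≤ M) :
    ‖reshuffleMean η x‖ ≤ ‖(n : ℝ)⁻¹ • ∑ i, gradStep η (x i)‖ ^ n := by
  have hn2 : (2 : ℝ) ≤ n := by exact_mod_cast hn
  have hn0 : (0 : ℝ) < n := by linarith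
  obtain ⟨u₀, hu₀, hmin⟩ := (isCompact_sphere (0 : E) 1).exists_isMinOn
    (NormedSpace.sphere_nonempty.2 zero_le_one)
    (f := fun u => ∑ i, ⟪x i, u⟫ ^ 2) (by fun_prop)
  rw [mem_sphere_zero_iff_norm] at hu₀
  set l := ∑ i, ⟪x i, u₀⟫ ^ 2 with hldef
  have hl0 : 0 ≤ l := Finset.sum_nonneg fun _ _ => sq_nonneg _
  have hlM : l ≤ M := hS u₀ hu₀
  have hscale (v : E) : l * ‖v‖ ^ 2 ≤ ∑ i, ⟪x i, v⟫ ^ 2 ∧ ∑ i, ⟪x i, v⟫ ^ 2 ≤ M * ‖v‖ ^ 2 := by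
    rcases eq_or_ne v 0 with rfl | hv
    · simp
    have hv' : ‖v‖ ≠ 0 := norm_ne_zero_iff.2 hv
    have hv1 : ‖‖v‖⁻¹ • v‖ = 1 := norm_smul_inv_norm hv
    have e : ∑ i, ⟪x i, v⟫ ^ 2 = (∑ i, ⟪x i, ‖v‖⁻¹ • v⟫ ^ 2) * ‖v‖ ^ 2 := by
      rw [Finset.sum_mul]
      refine Finset.sum_congr rfl fun i _ => ?_
      rw [real_inner_smul_right]
      field_simp
    rw [e]
    exact ⟨mul_le_mul_of_nonneg_right (hmin (mem_sphere_zero_iff_norm.2 hv1)) (sq_nonneg _),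
      mul_le_mul_of_nonneg_right (hS _ hv1) (sq_nonneg _)⟩
  have hMle : M ≤ n := by linarith
  have hηM : η * M ≤ 1 / 6 := (mul_le_mul_of_nonneg_left hMle hη).trans hηn
  have hηl : η * l ≤ 1 / 6 := (mul_le_mul_of_nonneg_left hlM hη).trans hηM
  have hy0 : 0 ≤ η * l / n := by positivity
  have hy1 : η * l / n ≤ 1 / 6 := by
    rw [div_le_iff₀ hn0]
    linarith
  have hG : 1 - η * l / n ≤ ‖(n : ℝ)⁻¹ • ∑ i, gradStep η (x i)‖ := by
    have h := quadratic_gradMean (by omega : n ≠ 0) η x u₀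
    rw [hu₀, ← hldef] at h
    calc 1 - η * l / n = ⟪u₀, ((n : ℝ)⁻¹ • ∑ i, gradStep η (x i)) u₀⟫ := by rw [h]; ring
      _ ≤ ‖u₀‖ * ‖((n : ℝ)⁻¹ • ∑ i, gradStep η (x i)) u₀‖ := real_inner_le_norm _ _
      _ ≤ ‖u₀‖ * (‖(n : ℝ)⁻¹ • ∑ i, gradStep η (x i)‖ * ‖u₀‖) :=
        mul_le_mul_of_nonneg_left (ContinuousLinearMap.le_opNorm _ _) (norm_nonneg _)
      _ = _ := by rw [hu₀]; ring
  refine le_trans ?_ (pow_le_pow_left₀ (by linarith) hG n)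
  have hr2 : r ^ 2 ≤ 1 := pow_le_one₀ hr hr1
  have hc := second_order_le_one_sub_pow hn hη hηn hrn hl0 (hlM.trans hMn)
    ((pow_le_pow_left₀ hl0 hlM 2).trans hM2)
  refine opNorm_le_of_quadratic_le (inner_reshuffleMean_comm η x) (pow_pos (by linarith) n)
    (fun v => ?_) fun v => ?_
  all_goals
    have hq := abs_le.1 (abs_quadratic_reshuffleMean_sub_le hη hηn hr hr1 hrn x h1 hx v)
    have hcov := norm_sq_cov_le x hl0 hM (fun w => (hscale w).1) (fun w => (hscale w).2) v
    obtain ⟨hsl, hsM⟩ := hscale v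
    have hs0 : 0 ≤ ∑ i, ⟪x i, v⟫ ^ 2 := Finset.sum_nonneg fun _ _ => sq_nonneg _
    have hW0 : 0 ≤ ‖∑ i, ⟪x i, v⟫ • x i‖ ^ 2 := sq_nonneg _
    have hN0 : 0 ≤ ‖v‖ ^ 2 := sq_nonneg _
    generalize ‖∑ i, ⟪x i, v⟫ • x i‖ ^ 2 = W at *
    generalize ∑ i, ⟪x i, v⟫ ^ 2 = s at *
    generalize ‖v‖ ^ 2 = N at *
  · have hη1 : η ≤ 1 := by nlinarith
    have h2 : η * s ≤ 1 / 6 * N := by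
      linarith [mul_le_mul_of_nonneg_left hsM hη, mul_le_mul_of_nonneg_right hηM hN0]
    have h3 := mul_le_mul_of_nonneg_right hη1 (mul_nonneg hη hs0)
    have h4 := mul_nonneg (mul_nonneg (sq_nonneg η) hs0) (sq_nonneg r)
    have h5 := mul_nonneg (sq_nonneg η) hW0
    linarith [mul_nonneg hη hs0]
  · refine le_trans ?_ (mul_le_mul_of_nonneg_right hc hN0)
    have hκ : 0 ≤ 1 / 2 - (1 - r ^ 2) / 5 := by linarith [sq_nonneg r]
    have h3 : η ^ 2 * (1 / 2 - (1 - r ^ 2) / 5) * (l * N)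
        ≤ η ^ 2 * (1 / 2 - (1 - r ^ 2) / 5) * s :=
      mul_le_mul_of_nonneg_left hsl (by positivity)
    have h4 := mul_le_mul_of_nonneg_left hcov (by positivity : 0 ≤ η ^ 2 / 2)
    have h5 : 0 ≤ η * (s - l * N) * (1 - (η * M + 2 * (η * l)) / 2) :=
      mul_nonneg (mul_nonneg hη (by linarith)) (by linarith)
    linarith [hq.2]

end QuadraticForms

open Matrix in
/-- Let n ≥ 2, K ≥ 1, d ≤ n, and let x_1,…,x_n be unit vectors in ℝ^d with
(A1) |xᵢᵀxⱼ| ≤ n^{-1/2} for i ≠ j and (A2) n^{-1/4} ≤ Σᵢ (uᵀxᵢ)² ≤ n^{1/4} for all unit u.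
Then for all η ∈ [0, 1/(6n)], with A_i = I - η x_i x_iᵀ, we have ‖W_RS‖ ≤ ‖W_GD‖. -/
theorem statement3 (n K d : ℕ) (hn : 2 ≤ n) (hK : 1 ≤ K) (hd : d ≤ n)
    (x : Fin n → Fin d → ℝ)
    (hunit : ∀ i, x i ⬝ᵥ x i = 1)
    (hA1 : ∀ i j, i ≠ j → |x i ⬝ᵥ x j| ≤ (n : ℝ) ^ (-(1 / 2) : ℝ))
    (hA2 : ∀ u : Fin d → ℝ, u ⬝ᵥ u = 1 →
      (n : ℝ) ^ (-(1 / 4) : ℝ) ≤ ∑ i : Fin n, (u ⬝ᵥ x i) ^ 2 ∧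
      ∑ i : Fin n, (u ⬝ᵥ x i) ^ 2 ≤ (n : ℝ) ^ ((1 / 4) : ℝ)) :
    ∀ η ∈ Set.Icc (0 : ℝ) (1 / (6 * (n : ℝ))),
      specNorm (WRS n K (fun i => 1 - η • Matrix.vecMulVec (x i) (x i))) ≤
        specNorm (WGD n K (fun i => 1 - η • Matrix.vecMulVec (x i) (x i))) := by
  rintro η ⟨hη0, hη1⟩
  have hn2 : (2 : ℝ) ≤ n := by exact_mod_cast hn
  have hn0 : (0 : ℝ) < n := by linarith
  rcases Nat.eq_zero_or_pos d with rfl | hd0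
  · rw [Subsingleton.elim (WRS n K fun i => 1 - η • vecMulVec (x i) (x i))]
  have : Nonempty (Fin d) := ⟨⟨0, hd0⟩⟩
  set y : Fin n → EuclideanSpace ℝ (Fin d) := fun i => WithLp.toLp 2 (x i)
  have hinner (u v : EuclideanSpace ℝ (Fin d)) : inner ℝ u v = v.ofLp ⬝ᵥ u.ofLp := by
    simp [EuclideanSpace.inner_eq_star_dotProduct]
  have hstep (i : Fin n) : toEuclideanCLM (𝕜 := ℝ) (1 - η • vecMulVec (x i) (x i))
      = gradStep η (y i) := by
    ext u j
    simp only [map_sub, map_one, map_smul, gradStep_apply, _root_.sub_apply,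
      _root_.smul_apply, one_apply_eq_self, PiLp.sub_apply,
      PiLp.smul_apply, ofLp_toEuclideanCLM, vecMulVec_mulVec, hinner, y, dotProduct_comm (x i),
      Pi.smul_apply, MulOpposite.smul_eq_mul_unop, MulOpposite.unop_op, smul_eq_mul]
    ring
  have hRS : toEuclideanCLM (𝕜 := ℝ) (WRS n K fun i => 1 - η • vecMulVec (x i) (x i))
      = reshuffleMean η y ^ K := by
    simp only [WRS, permProd, reshuffleMean, gradProd, map_pow, map_smul, map_sum, map_list_prod,
      List.map_ofFn, Function.comp_def, hstep]
  have hGD : toEuclideanCLM (𝕜 := ℝ) (WGD n K fun i => 1 - η • vecMulVec (x i) (x i))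
      = ((n : ℝ)⁻¹ • ∑ i, gradStep η (y i)) ^ (n * K) := by
    simp only [WGD, map_pow, map_smul, map_sum, hstep]
  rw [specNorm, specNorm, hRS, hGD, 
    (isSelfAdjoint_gradMean η y).norm_pow_eq (n * K), pow_mul]
  refine (norm_pow_le _ K).trans (pow_le_pow_left₀ (norm_nonneg _) ?_ K)
  have hM4 : ((n : ℝ) ^ (1 / 4 : ℝ)) ^ 2 = (n : ℝ) ^ (1 / 2 : ℝ) := by
    rw [← Real.rpow_natCast, ← Real.rpow_mul hn0.le]
    norm_num
  refine norm_reshuffleMean_le hn (r := (n : ℝ) ^ (-(1 / 2) : ℝ)) (M := (n : ℝ) ^ (1 / 4 : ℝ))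
    hη0 ?_ (by positivity) ?_ ?_ (by positivity) ?_ ?_ y ?_ ?_ ?_
  · calc η * n ≤ 1 / (6 * n) * n := mul_le_mul_of_nonneg_right hη1 hn0.le
      _ = 1 / 6 := by field_simp
  · exact Real.rpow_le_one_of_one_le_of_nonpos (by linarith) (by norm_num)
  · rw [← Real.rpow_natCast, ← Real.rpow_mul hn0.le]
    norm_num [Real.rpow_neg_one, hn0.ne']
  · have h := rpow_one_add_le_one_add_mul_self (s := (n : ℝ) - 1) (by linarith)
      (p := 1 / 4) (by norm_num) (by norm_num)
    rw [add_sub_cancel] at h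
    linarith
  · rw [hM4]
    exact Real.rpow_le_self_of_one_le (by linarith) (by norm_num)
  · intro i
    rw [← sq_eq_sq₀ (norm_nonneg _) zero_le_one, ← real_inner_self_eq_norm_sq, hinner, one_pow]
    exact hunit i
  · intro i j hij
    rw [hinner]
    exact hA1 j i hij.symm
  · intro u hu
    have h : u.ofLp ⬝ᵥ u.ofLp = 1 := by
      rw [← hinner, real_inner_self_eq_norm_sq, hu, one_pow]
    simpa only [hinner] using (hA2 u.ofLp h).2
end

section
/- Let x_1, …, x_n ∈ ℝ^d (d ≤ n) be unit vectors with |x_i^T x_j| ≤ δ for all i ≠ j, and let s_max and s_min be the maximum and minimum eigenvalues of Σ_{i=1}^n x_i x_i^T. Set A_i := I − η x_i x_i^T for η ≥ 0. Then the minimum eigenvalue of W_GD(n,1,A_1,…,A_n) − W_RS(n,1,A_1,…,A_n) is at least η^2 (n−1)(1−δ) s_min/(2n) − Σ_{m=4}^{n} η^m (s_max^m + s_max n^{m−1} δ^{m−1}) − (η^3/6)(3 s_max^3/n + s_max n^{1/2} (n^2 δ^4 + 6 n δ^2 + 1)^{1/2}). -/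
open Matrix

/-- The sum of the ordered products `B (f 0) * ⋯ * B (f (m - 1))` over all injections `f`. -/
noncomputable def injProdSum {n : ℕ} {R : Type*} [Semiring R] (B : Fin n → R) (m : ℕ) : R :=
  ∑ f : Fin m ↪ Fin n, (List.ofFn fun i => B (f i)).prod

section Expansion

variable {R : Type*} [Semiring R] {α : Type*}

theorem List.prod_map_one_add_eq_sum_sublists' (B : α → R) (l : List α) :
    (l.map fun a => 1 + B a).prod = (l.sublists'.map fun s => (s.map B).prod).sum := by
  induction l with
  | nil => simp
  | cons a l ih =>
    simp only [List.map_cons, List.prod_cons, List.sublists'_cons, List.map_append,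
      List.sum_append, List.map_map, ih, add_mul, one_mul]
    congr 1
    rw [← List.sum_map_mul_left]
    simp [Function.comp_def]

theorem List.prod_map_one_add_eq_sum_sublistsLen (B : α → R) (l : List α) :
    (l.map fun a => 1 + B a).prod = ∑ m ∈ Finset.range (l.length + 1),
      ((l.sublistsLen m).map fun s => (s.map B).prod).sum := by
  rw [List.prod_map_one_add_eq_sum_sublists',
    ← ((List.range_bind_sublistsLen_perm l).map _).sum_eq]
  rw [List.map_flatMap, List.flatMap_def, List.sum_flatten, List.map_map, ← List.toFinset_range,
    List.sum_toFinset _ List.nodup_range]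
  rfl

theorem Finset.sum_list_map_sum {M β : Type*} [AddCommMonoid M] (s : Finset β) (l : List α)
    (f : β → α → M) : ∑ b ∈ s, (l.map (f b)).sum = (l.map fun a => ∑ b ∈ s, f b a).sum := by
  induction l with
  | nil => simp
  | cons a l ih => simp [Finset.sum_add_distrib, ih]

end Expansion

/-- Averaging over permutations: every injection contributes equally. -/
theorem card_smul_sum_perm_smul_embedding {ι α M : Type*} [Fintype ι] [Fintype α] [DecidableEq α]
    [DecidableEq ι] [AddCommMonoid M] (F : (ι ↪ α) → M) (g : ι ↪ α) :
    Fintype.card (ι ↪ α) • ∑ σ : Equiv.Perm α, F (σ • g)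
      = (Fintype.card α).factorial • ∑ f : ι ↪ α, F f := by
  have h1 : ∀ g' : ι ↪ α, ∑ σ : Equiv.Perm α, F (σ • g') = ∑ σ : Equiv.Perm α, F (σ • g) := by
    intro g'
    obtain ⟨τ, rfl⟩ := Equiv.Perm.exists_smul_eq_embedding g g'
    simp only [← mul_smul]
    exact Equiv.sum_comp (Equiv.mulRight τ) fun σ => F (σ • g)
  calc _ = ∑ g' : ι ↪ α, ∑ σ : Equiv.Perm α, F (σ • g') := by
        rw [Finset.sum_congr rfl fun g' _ => h1 g', Finset.sum_const, Finset.card_univ]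
    _ = ∑ σ : Equiv.Perm α, ∑ g' : ι ↪ α, F (σ • g') := Finset.sum_comm
    _ = ∑ σ : Equiv.Perm α, ∑ g' : ι ↪ α, F g' := Finset.sum_congr rfl fun σ _ =>
        Equiv.sum_comp (MulAction.toPerm σ) F
    _ = _ := by rw [Finset.sum_const, Finset.card_univ, Fintype.card_perm]

theorem sum_perm_prod_map_of_nodup {R : Type*} [Ring R] [Algebra ℝ R] {n : ℕ} (B : Fin n → R)
    (l : List (Fin n)) (hl : l.Nodup) :
    ∑ σ : Equiv.Perm (Fin n), (l.map fun i => B (σ i)).prod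
      = ((n.factorial : ℝ) / (n.descFactorial l.length : ℝ)) • injProdSum B l.length := by
  let g : Fin l.length ↪ Fin n := ⟨l.get, List.nodup_iff_injective_get.1 hl⟩
  have h := card_smul_sum_perm_smul_embedding
    (fun f : Fin l.length ↪ Fin n => (List.ofFn fun i => B (f i)).prod) g
  have hN : (n.descFactorial l.length : ℝ) ≠ 0 := by
    rw [Nat.cast_ne_zero, Ne, Nat.descFactorial_eq_zero_iff_lt, not_lt]
    simpa using hl.length_le_card
  simp only [Fintype.card_embedding_eq, Fintype.card_fin, ← Nat.cast_smul_eq_nsmul ℝ] at h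
  rw [div_eq_inv_mul, mul_smul, injProdSum, ← h, inv_smul_smul₀ hN]
  refine Finset.sum_congr rfl fun σ _ => ?_
  congr 1
  conv_lhs => rw [← List.ofFn_get l, List.map_ofFn]
  rfl

/-- Expansion of the average over orderings of a product of perturbations of the identity. -/
theorem average_perm_prod_one_add {R : Type*} [Ring R] [Algebra ℝ R] {n : ℕ} (B : Fin n → R) :
    (n.factorial : ℝ)⁻¹ • ∑ σ : Equiv.Perm (Fin n), (List.ofFn fun i => 1 + B (σ i)).prod
      = ∑ m ∈ Finset.range (n + 1), (m.factorial : ℝ)⁻¹ • injProdSum B m := by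
  have h : ∀ σ : Equiv.Perm (Fin n), (List.ofFn fun i => 1 + B (σ i)).prod
      = ∑ m ∈ Finset.range (n + 1), (((List.finRange n).sublistsLen m).map
        fun s => (s.map fun i => B (σ i)).prod).sum := by
    intro σ
    have := List.prod_map_one_add_eq_sum_sublistsLen (fun i => B (σ i)) (List.finRange n)
    rw [List.length_finRange] at this
    rw [← this, List.ofFn_eq_map]
  simp only [h]
  rw [Finset.sum_comm, Finset.smul_sum]
  refine Finset.sum_congr rfl fun m hm => ?_
  have hmn : m ≤ n := Nat.lt_succ_iff.1 (Finset.mem_range.1 hm)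
  have h2 : ∀ s ∈ (List.finRange n).sublistsLen m,
      ∑ σ : Equiv.Perm (Fin n), (s.map fun i => B (σ i)).prod
        = ((n.factorial : ℝ) / (n.descFactorial m : ℝ)) • injProdSum B m := by
    intro s hs
    obtain ⟨hsub, rfl⟩ := List.mem_sublistsLen.1 hs
    exact sum_perm_prod_map_of_nodup B s (hsub.nodup (List.nodup_finRange n))
  rw [Finset.sum_list_map_sum, List.map_congr_left h2, List.map_const', List.sum_replicate,
    List.length_sublistsLen, List.length_finRange, ← Nat.cast_smul_eq_nsmul ℝ, smul_smul,
    smul_smul]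
  congr 1
  have hN : (n.descFactorial m : ℝ) ≠ 0 := by
    rw [Nat.cast_ne_zero, Ne, Nat.descFactorial_eq_zero_iff_lt, not_lt]
    exact hmn
  have hc : (n.descFactorial m : ℝ) = m.factorial * n.choose m := by
    exact_mod_cast Nat.descFactorial_eq_factorial_mul_choose n m
  have hm0 : (m.factorial : ℝ) ≠ 0 := by positivity
  have hn0 : (n.factorial : ℝ) ≠ 0 := by positivity
  field_simp
  rw [hc]; ring

theorem injProdSum_smul {R : Type*} [Ring R] [Algebra ℝ R] {n : ℕ} (t : ℝ) (B : Fin n → R)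
    (m : ℕ) : injProdSum (fun i => t • B i) m = t ^ m • injProdSum B m := by
  rw [injProdSum, injProdSum, Finset.smul_sum]
  refine Finset.sum_congr rfl fun f _ => ?_
  have := List.smul_prod (List.ofFn fun i => B (f i)) t
  rw [List.length_ofFn, List.map_ofFn] at this
  exact this.symm

section LowOrder

variable {n : ℕ} {R : Type*}

theorem injProdSum_eq_sum_ite [Semiring R] (B : Fin n → R) (m : ℕ) :
    injProdSum B m = ∑ f : Fin m → Fin n,
      if Function.Injective f then (List.ofFn fun i => B (f i)).prod else 0 := by
  classical
  rw [injProdSum, ← Finset.sum_filter]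
  rw [← Equiv.sum_comp (Equiv.subtypeInjectiveEquivEmbedding (Fin m) (Fin n))]
  rw [Finset.sum_subtype (p := Function.Injective) _ (by simp)]
  rfl

theorem injProdSum_of_lt [Semiring R] (B : Fin n → R) {m : ℕ} (h : n < m) :
    injProdSum B m = 0 := by
  have : IsEmpty (Fin m ↪ Fin n) := by
    rw [← Fintype.card_eq_zero_iff, Fintype.card_embedding_eq]
    simpa using h
  simp [injProdSum]

theorem injProdSum_zero [Semiring R] (B : Fin n → R) : injProdSum B 0 = 1 := by
  simp [injProdSum]

theorem injProdSum_one [Semiring R] (B : Fin n → R) : injProdSum B 1 = ∑ i, B i := by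
  rw [injProdSum_eq_sum_ite, ← Equiv.sum_comp (Equiv.funUnique (Fin 1) (Fin n)).symm]
  simp [Function.injective_of_subsingleton]

theorem injProdSum_two [Ring R] (B : Fin n → R) (hB : ∀ i, B i * B i = B i) :
    injProdSum B 2 = (∑ i, B i) ^ 2 - ∑ i, B i := by
  have h : ∀ i j : Fin n, (if Function.Injective ![i, j] then B i * B j else 0)
      = B i * B j - if i = j then B i * B j else 0 := by
    intro i j
    have : Function.Injective ![i, j] ↔ i ≠ j := by
      simp [Function.Injective, Fin.forall_fin_succ, eq_comm]
    by_cases hij : i = j <;> simp [this, hij]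
  rw [injProdSum_eq_sum_ite, ← Equiv.sum_comp (finTwoArrowEquiv (Fin n)).symm,
    Fintype.sum_prod_type]
  simp only [finTwoArrowEquiv_symm_apply, List.ofFn_succ, List.ofFn_zero]
  simp only [Matrix.cons_val_zero, Fin.succ_zero_eq_one, Matrix.cons_val_one, List.prod_cons,
    List.prod_nil, mul_one]
  simp only [h, Finset.sum_sub_distrib, Finset.sum_ite_eq, Finset.mem_univ, if_true, hB, pow_two,
    Finset.sum_mul_sum]

theorem injProdSum_three [Ring R] (B : Fin n → R) (hB : ∀ i, B i * B i = B i) :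
    injProdSum B 3 = (∑ i, B i) ^ 3 - 2 * (∑ i, B i) ^ 2 - ∑ i, B i * (∑ j, B j) * B i
      + 2 * ∑ i, B i := by
  have h : ∀ i j k : Fin n, (if Function.Injective ![i, j, k] then B i * (B j * B k) else 0)
      = B i * (B j * B k) - (if i = j then B i * (B j * B k) else 0)
        - (if j = k then B i * (B j * B k) else 0)
        - (if i = k then B i * (B j * B k) else 0)
        + 2 * (if i = j then if j = k then B i * (B j * B k) else 0 else 0) := by
    intro i j k
    have : Function.Injective ![i, j, k] ↔ i ≠ j ∧ j ≠ k ∧ i ≠ k := by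
      simp [Function.Injective, Fin.forall_fin_succ]
      grind
    by_cases hij : i = j <;> by_cases hjk : j = k <;> by_cases hik : i = k <;>
      simp_all
    noncomm_ring
  have e : ∀ F : (Fin 3 → Fin n) → R, ∑ f, F f = ∑ i, ∑ j, ∑ k, F ![i, j, k] := by
    intro F
    rw [← Equiv.sum_comp (Fin.consEquiv fun _ : Fin 3 => Fin n), Fintype.sum_prod_type]
    refine Finset.sum_congr rfl fun i _ => ?_
    rw [← Equiv.sum_comp (finTwoArrowEquiv (Fin n)).symm, Fintype.sum_prod_type]
    rfl
  rw [injProdSum_eq_sum_ite, e]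
  simp only [List.ofFn_succ, List.ofFn_zero]
  simp only [Matrix.cons_val_zero, Fin.succ_zero_eq_one, Fin.succ_one_eq_two, Matrix.cons_val_one,
    Matrix.cons_val, List.prod_cons, List.prod_nil, mul_one]
  have hs : ∀ (i : Fin n) (F : Fin n → Fin n → R),
      ∑ j, ∑ k, (if i = j then F j k else 0) = ∑ k, F i k := by
    intro i F
    rw [Finset.sum_comm]
    simp
  simp only [h, Finset.sum_sub_distrib, Finset.sum_add_distrib, hs]
  simp only [← Finset.mul_sum, Finset.sum_ite_eq, Finset.mem_univ, if_true, hB]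
  have h2 : ∀ i, B i * (B i * ∑ k, B k) = B i * ∑ k, B k := fun i => by rw [← mul_assoc, hB]
  have h3 : ∀ i, ∑ j, ∑ k, (if i = j then if j = k then B i * (B j * B k) else 0 else 0) = B i := by
    intro i
    rw [hs i fun j k => if j = k then B i * (B j * B k) else 0]
    simp [hB]
  simp only [h2, h3, ← Finset.sum_mul, mul_assoc]
  noncomm_ring

end LowOrder

section QuadraticForm

variable {ι κ : Type*} [Fintype ι] [Fintype κ]

/-- The value `v ⬝ᵥ M *ᵥ v` as a linear function of the matrix `M`. -/
def quadVal (v : ι → ℝ) : Matrix ι ι ℝ →ₗ[ℝ] ℝ where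
  toFun M := v ⬝ᵥ M *ᵥ v
  map_add' M N := by rw [Matrix.add_mulVec, dotProduct_add]
  map_smul' c M := by rw [Matrix.smul_mulVec, dotProduct_smul]; rfl

theorem quadVal_apply (v : ι → ℝ) (M : Matrix ι ι ℝ) : quadVal v M = v ⬝ᵥ M *ᵥ v := rfl

theorem quadVal_vecMulVec (v x : ι → ℝ) : quadVal v (vecMulVec x x) = (x ⬝ᵥ v) ^ 2 := by
  rw [quadVal_apply, vecMulVec_mulVec, dotProduct_smul, dotProduct_comm v x, pow_two]
  simp

theorem vecMulVec_mulVec_eq_smul (x y w : ι → ℝ) : vecMulVec x y *ᵥ w = (y ⬝ᵥ w) • x := by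
  rw [vecMulVec_mulVec, op_smul_eq_smul]

theorem quadVal_one [DecidableEq ι] (v : ι → ℝ) : quadVal v 1 = v ⬝ᵥ v := by
  rw [quadVal_apply, one_mulVec]

theorem quadVal_gram (v : ι → ℝ) (x : κ → ι → ℝ) :
    quadVal v (∑ i, vecMulVec (x i) (x i)) = ∑ i, (x i ⬝ᵥ v) ^ 2 := by
  simp only [map_sum, quadVal_vecMulVec]

theorem quadVal_gram_sq [DecidableEq ι] (v : ι → ℝ) (x : κ → ι → ℝ) :
    quadVal v ((∑ i, vecMulVec (x i) (x i)) ^ 2)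
      = ∑ i, ∑ j, (x i ⬝ᵥ x j) * ((x i ⬝ᵥ v) * (x j ⬝ᵥ v)) := by
  rw [pow_two, Finset.sum_mul_sum]
  simp only [map_sum]
  refine Finset.sum_congr rfl fun i _ => Finset.sum_congr rfl fun j _ => ?_
  simp only [quadVal_apply, ← mulVec_mulVec, vecMulVec_mulVec_eq_smul, mulVec_smul,
    dotProduct_smul, smul_eq_mul, dotProduct_comm v (x i)]
  ring

theorem quadVal_sum_vecMulVec_gram [DecidableEq ι] (v : ι → ℝ) (x : κ → ι → ℝ) :
    quadVal v (∑ i, vecMulVec (x i) (x i) * (∑ j, vecMulVec (x j) (x j)) * vecMulVec (x i) (x i))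
      = ∑ i, (∑ j, (x i ⬝ᵥ x j) ^ 2) * (x i ⬝ᵥ v) ^ 2 := by
  rw [map_sum]
  refine Finset.sum_congr rfl fun i _ => ?_
  rw [Finset.mul_sum, Finset.sum_mul, map_sum, Finset.sum_mul]
  refine Finset.sum_congr rfl fun j _ => ?_
  simp only [quadVal_apply, ← mulVec_mulVec, vecMulVec_mulVec_eq_smul, mulVec_smul,
    dotProduct_smul, smul_eq_mul, dotProduct_comm v (x i),
    dotProduct_comm (x j) (x i)]
  ring

theorem vecMulVec_mul_self_of_unit (x : ι → ℝ) (hx : x ⬝ᵥ x = 1) :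
    vecMulVec x x * vecMulVec x x = vecMulVec x x := by
  rw [vecMulVec_mul_vecMulVec, hx, one_smul]

/-- In an eigenbasis, the quadratic forms of all powers are diagonal simultaneously. -/
theorem exists_quadVal_pow_eq [DecidableEq ι] {H : Matrix ι ι ℝ} (hH : H.IsHermitian)
    (v : ι → ℝ) :
    ∃ c : ι → ℝ, ∀ m : ℕ, quadVal v (H ^ m) = ∑ k, hH.eigenvalues k ^ m * c k ^ 2 := by
  let U : Matrix ι ι ℝ := hH.eigenvectorUnitary
  refine ⟨star U *ᵥ v, fun m => ?_⟩
  have h1 : H ^ m = U * diagonal (fun k => hH.eigenvalues k ^ m) * star U := by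
    conv_lhs => rw [hH.spectral_theorem]
    rw [← map_pow, Matrix.diagonal_pow]
    rfl
  rw [h1, quadVal_apply, ← mulVec_mulVec, ← mulVec_mulVec, dotProduct_mulVec]
  have h2 : v ᵥ* U = star U *ᵥ v := by
    rw [star_eq_conjTranspose, conjTranspose_eq_transpose_of_trivial, mulVec_transpose]
  rw [h2]
  simp only [dotProduct, mulVec_diagonal]
  refine Finset.sum_congr rfl fun k _ => ?_
  ring

end QuadraticForm

section Estimates

variable {ι : Type*} [Fintype ι]

theorem abs_dotProduct_prod_mulVec_le [DecidableEq ι] {κ : Type*} {x : κ → ι → ℝ} {δ : ℝ}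
    (hδ0 : 0 ≤ δ) (hδ : ∀ i j, i ≠ j → |x i ⬝ᵥ x j| ≤ δ) (v : ι → ℝ) (m : ℕ)
    (f : Fin (m + 1) → κ) (hf : Function.Injective f) (w : ι → ℝ) :
    |w ⬝ᵥ (List.ofFn fun i => vecMulVec (x (f i)) (x (f i))).prod *ᵥ v|
      ≤ δ ^ m * (|w ⬝ᵥ x (f 0)| * |x (f (Fin.last m)) ⬝ᵥ v|) := by
  induction m generalizing w with
  | zero =>
    simp [vecMulVec_mulVec_eq_smul, abs_mul, mul_comm]
  | succ m ih =>
    rw [List.ofFn_succ, List.prod_cons, ← mulVec_mulVec, vecMulVec_mulVec_eq_smul,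
      dotProduct_smul, smul_eq_mul, abs_mul]
    have h1 := ih (fun i => f i.succ) (hf.comp (Fin.succ_injective _)) (x (f 0))
    have h2 : |x (f 0) ⬝ᵥ x (f (Fin.succ 0))| ≤ δ :=
      hδ _ _ (hf.ne (Fin.succ_ne_zero _).symm)
    rw [Fin.succ_last] at h1
    calc _ ≤ δ ^ m * (δ * |x (f (Fin.last (m + 1))) ⬝ᵥ v|) * |w ⬝ᵥ x (f 0)| := by
          gcongr
          exact h1.trans (by gcongr)
      _ = _ := by ring

theorem abs_quadVal_injProdSum_le [DecidableEq ι] {n : ℕ} {x : Fin n → ι → ℝ} {δ : ℝ}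
    (hδ0 : 0 ≤ δ) (hδ : ∀ i j, i ≠ j → |x i ⬝ᵥ x j| ≤ δ) (v : ι → ℝ) (m : ℕ) :
    |quadVal v (injProdSum (fun i => vecMulVec (x i) (x i)) (m + 1))|
      ≤ (n : ℝ) ^ m * δ ^ m * ∑ i, (x i ⬝ᵥ v) ^ 2 := by
  have hsum : ∀ j : Fin (m + 1), ∑ f : Fin (m + 1) → Fin n, (x (f j) ⬝ᵥ v) ^ 2
      = (n : ℝ) ^ m * ∑ i, (x i ⬝ᵥ v) ^ 2 := by
    intro j
    have := Fintype.sum_piFinset_apply (fun i => (x i ⬝ᵥ v) ^ 2) Finset.univ j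
    simpa using this
  rw [injProdSum_eq_sum_ite, map_sum]
  calc _ ≤ ∑ f : Fin (m + 1) → Fin n,
        δ ^ m * (((x (f 0) ⬝ᵥ v) ^ 2 + (x (f (Fin.last m)) ⬝ᵥ v) ^ 2) / 2) := by
        refine (Finset.abs_sum_le_sum_abs _ _).trans (Finset.sum_le_sum fun f _ => ?_)
        split_ifs with hf
        · refine (abs_dotProduct_prod_mulVec_le hδ0 hδ v m f hf v).trans ?_
          gcongr
          rw [dotProduct_comm v, ← sq_abs (x (f 0) ⬝ᵥ v), ← sq_abs (x (f (Fin.last m)) ⬝ᵥ v)]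
          linarith [two_mul_le_add_sq |x (f 0) ⬝ᵥ v| |x (f (Fin.last m)) ⬝ᵥ v|]
        · rw [map_zero, abs_zero]
          positivity
    _ = _ := by
        rw [← Finset.mul_sum, ← Finset.sum_div, Finset.sum_add_distrib, hsum, hsum]
        ring

variable {κ : Type*} [Fintype κ] [DecidableEq κ] {G : κ → κ → ℝ} {δ : ℝ}

theorem sum_gram_le (hG : ∀ i, G i i = 1) (hδ : ∀ i j, i ≠ j → |G i j| ≤ δ) (u : κ → ℝ) :
    ∑ i, ∑ j, G i j * (u i * u j) ≤ (1 + ((Fintype.card κ : ℝ) - 1) * δ) * ∑ i, u i ^ 2 := by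
  have h : ∀ i j, G i j * (u i * u j)
      ≤ δ * ((u i ^ 2 + u j ^ 2) / 2) + if i = j then (1 - δ) * u i ^ 2 else 0 := by
    intro i j
    by_cases hij : i = j
    · subst hij
      rw [hG, if_pos rfl]
      linarith
    · rw [if_neg hij, add_zero]
      have h1 : |u i * u j| ≤ (u i ^ 2 + u j ^ 2) / 2 := by
        rw [abs_mul, ← sq_abs (u i), ← sq_abs (u j)]
        linarith [two_mul_le_add_sq |u i| |u j|]
      have h0 : 0 ≤ δ := (abs_nonneg _).trans (hδ i j hij)
      calc _ ≤ |G i j| * |u i * u j| := by rw [← abs_mul]; exact le_abs_self _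
        _ ≤ _ := by
          gcongr
          exact hδ i j hij
  calc _ ≤ _ := Finset.sum_le_sum fun i _ => Finset.sum_le_sum fun j _ => h i j
    _ = _ := by
      simp only [Finset.sum_add_distrib, ← Finset.mul_sum, ← Finset.sum_div, Finset.sum_const,
        Finset.card_univ, nsmul_eq_mul, Finset.sum_ite_eq, Finset.mem_univ, if_true]
      ring

theorem third_order_gram_le (hG : ∀ i, G i i = 1) (hδ : ∀ i j, i ≠ j → |G i j| ≤ δ)
    (u : κ → ℝ) :
    2 * ∑ i, ∑ j, G i j * (u i * u j) - 2 * ∑ i, u i ^ 2 + ∑ i, (∑ j, G i j ^ 2) * u i ^ 2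
      ≤ √(Fintype.card κ : ℝ)
        * √((Fintype.card κ : ℝ) ^ 2 * δ ^ 4 + 6 * (Fintype.card κ : ℝ) * δ ^ 2 + 1)
        * ∑ i, u i ^ 2 := by
  set n := (Fintype.card κ : ℝ) with hn
  set S : κ → ℝ := fun i => ∑ j ∈ Finset.univ.erase i, G i j ^ 2 with hS
  set C : κ → κ → ℝ := fun i j => if i = j then 1 + S i else 2 * G i j with hC
  have hS0 : ∀ i, 0 ≤ S i := fun i => Finset.sum_nonneg fun j _ => sq_nonneg _
  have hSn : ∀ i, S i ≤ n * δ ^ 2 := by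
    intro i
    calc S i ≤ ∑ j ∈ Finset.univ.erase i, δ ^ 2 := Finset.sum_le_sum fun j hj => by
          rw [← sq_abs]
          exact pow_le_pow_left₀ (abs_nonneg _) (hδ i j (Finset.ne_of_mem_erase hj).symm) 2
      _ ≤ ∑ j : κ, δ ^ 2 := Finset.sum_le_sum_of_subset_of_nonneg (Finset.erase_subset _ _)
          fun _ _ _ => sq_nonneg _
      _ = n * δ ^ 2 := by simp [hn]
  have hrow : ∀ i, ∑ j, C i j ^ 2 ≤ n ^ 2 * δ ^ 4 + 6 * n * δ ^ 2 + 1 := by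
    intro i
    have h1 : ∑ j, C i j ^ 2 = (1 + S i) ^ 2 + 4 * S i := by
      rw [← Finset.add_sum_erase _ _ (Finset.mem_univ i), hS, Finset.mul_sum]
      simp only [hC, if_true]
      congr 1
      refine Finset.sum_congr rfl fun j hj => ?_
      rw [if_neg (Finset.ne_of_mem_erase hj).symm]
      ring
    rw [h1]
    nlinarith [hS0 i, hSn i]
  have heq : 2 * ∑ i, ∑ j, G i j * (u i * u j) - 2 * ∑ i, u i ^ 2
      + ∑ i, (∑ j, G i j ^ 2) * u i ^ 2 = ∑ p : κ × κ, C p.1 p.2 * (u p.1 * u p.2) := by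
    rw [Fintype.sum_prod_type, Finset.mul_sum, Finset.mul_sum, ← Finset.sum_sub_distrib,
      ← Finset.sum_add_distrib]
    refine Finset.sum_congr rfl fun i _ => ?_
    rw [← Finset.add_sum_erase _ (fun j => G i j * (u i * u j)) (Finset.mem_univ i),
      ← Finset.add_sum_erase _ (fun j => C i j * (u i * u j)) (Finset.mem_univ i),
      ← Finset.add_sum_erase _ (fun j => G i j ^ 2) (Finset.mem_univ i)]
    have h2 : ∑ j ∈ Finset.univ.erase i, C i j * (u i * u j)
        = 2 * ∑ j ∈ Finset.univ.erase i, G i j * (u i * u j) := by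
      rw [Finset.mul_sum]
      refine Finset.sum_congr rfl fun j hj => ?_
      simp only [hC, if_neg (Finset.ne_of_mem_erase hj).symm]
      ring
    rw [h2, hG]
    simp only [hC, if_true, hS]
    ring
  have hC2 : ∑ p : κ × κ, C p.1 p.2 ^ 2 ≤ n * (n ^ 2 * δ ^ 4 + 6 * n * δ ^ 2 + 1) := by
    rw [Fintype.sum_prod_type]
    calc _ ≤ ∑ i : κ, (n ^ 2 * δ ^ 4 + 6 * n * δ ^ 2 + 1) := Finset.sum_le_sum fun i _ => hrow i
      _ = _ := by rw [Finset.sum_const, Finset.card_univ, nsmul_eq_mul]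
  have hu : ∑ p : κ × κ, (u p.1 * u p.2) ^ 2 = (∑ i, u i ^ 2) ^ 2 := by
    rw [Fintype.sum_prod_type, pow_two (∑ i, u i ^ 2), Finset.sum_mul_sum]
    simp only [mul_pow]
  rw [heq]
  refine (Real.sum_mul_le_sqrt_mul_sqrt _ _ _).trans ?_
  rw [hu, Real.sqrt_sq (Finset.sum_nonneg fun _ _ => sq_nonneg _),
    ← Real.sqrt_mul (Nat.cast_nonneg _)]
  gcongr

theorem second_order_gram_ge [Nonempty κ] (hG : ∀ i, G i i = 1) (hG1 : ∀ i j, |G i j| ≤ 1)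
    (hδ : ∀ i j, i ≠ j → |G i j| ≤ δ) (u : κ → ℝ) {a : ℝ} (ha : 0 ≤ a)
    (hau : a ≤ ∑ i, u i ^ 2) :
    ((Fintype.card κ : ℝ) - 1) * (1 - δ) * a
      ≤ (Fintype.card κ : ℝ) * ∑ i, u i ^ 2 - ∑ i, ∑ j, G i j * (u i * u j) := by
  have hn : (1 : ℝ) ≤ Fintype.card κ := by exact_mod_cast Fintype.card_pos
  rcases le_total δ 1 with h | h
  · have h1 := sum_gram_le hG hδ u
    have h2 : ((Fintype.card κ : ℝ) - 1) * (1 - δ) * a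
        ≤ ((Fintype.card κ : ℝ) - 1) * (1 - δ) * ∑ i, u i ^ 2 :=
      mul_le_mul_of_nonneg_left hau (mul_nonneg (by linarith) (by linarith))
    linarith
  · have h1 := sum_gram_le hG (fun i j _ => hG1 i j) u
    have h2 : 0 ≤ ((Fintype.card κ : ℝ) - 1) * (δ - 1) * a :=
      mul_nonneg (mul_nonneg (by linarith) (by linarith)) ha
    linarith

end Estimates

section Means

variable {n d : ℕ} (x : Fin n → Fin d → ℝ) (η : ℝ)

theorem WGD_one_eq_sum (hn : n ≠ 0) :
    WGD n 1 (fun i => 1 - η • vecMulVec (x i) (x i))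
      = ∑ m ∈ Finset.range (n + 1), ((-η) ^ m * (n.choose m / (n : ℝ) ^ m)) •
        (∑ i, vecMulVec (x i) (x i)) ^ m := by
  have hn' : (n : ℝ) ≠ 0 := by exact_mod_cast hn
  have h : (n : ℝ)⁻¹ • ∑ i : Fin n, (1 - η • vecMulVec (x i) (x i))
      = (-η / n) • (∑ i, vecMulVec (x i) (x i)) + 1 := by
    rw [Finset.sum_sub_distrib, ← Finset.smul_sum, smul_sub, smul_smul, Finset.sum_const,
      Finset.card_univ, Fintype.card_fin, ← Nat.cast_smul_eq_nsmul ℝ, inv_smul_smul₀ hn',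
      sub_eq_add_neg, add_comm, ← neg_smul, neg_div, div_eq_inv_mul]
  rw [WGD, mul_one, h, (Commute.one_right _).add_pow]
  refine Finset.sum_congr rfl fun m _ => ?_
  rw [one_pow, mul_one, smul_pow, ← nsmul_eq_mul', ← Nat.cast_smul_eq_nsmul ℝ, smul_smul]
  congr 1
  rw [div_pow]
  ring

theorem WRS_one_eq_sum :
    WRS n 1 (fun i => 1 - η • vecMulVec (x i) (x i))
      = ∑ m ∈ Finset.range (n + 1), ((-η) ^ m * (m.factorial : ℝ)⁻¹) •
        injProdSum (fun i => vecMulVec (x i) (x i)) m := by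
  have h := average_perm_prod_one_add fun i => (-η) • vecMulVec (x i) (x i)
  rw [WRS, pow_one]
  simp only [permProd, sub_eq_add_neg, ← neg_smul]
  rw [h]
  refine Finset.sum_congr rfl fun m _ => ?_
  rw [injProdSum_smul, smul_smul, mul_comm]

theorem WGD_isHermitian (K : ℕ) {A : Fin n → Matrix (Fin d) (Fin d) ℝ}
    (hA : ∀ i, (A i).IsHermitian) : (WGD n K A).IsHermitian := by
  refine IsSelfAdjoint.pow (IsSelfAdjoint.smul (IsSelfAdjoint.all _) ?_) _
  exact isSelfAdjoint_sum _ fun i _ => hA i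

theorem transpose_permProd {A : Fin n → Matrix (Fin d) (Fin d) ℝ}
    (hA : ∀ i, (A i)ᵀ = A i) (σ : Equiv.Perm (Fin n)) :
    (permProd A σ)ᵀ = permProd A (σ * Fin.revPerm) := by
  rw [permProd, permProd, transpose_list_prod, List.ofFn_eq_map, List.ofFn_eq_map, List.map_map,
    ← List.map_reverse, List.finRange_reverse, List.map_map]
  congr 2
  funext i
  simp [hA]

theorem WRS_isHermitian (K : ℕ) {A : Fin n → Matrix (Fin d) (Fin d) ℝ}
    (hA : ∀ i, (A i).IsHermitian) : (WRS n K A).IsHermitian := by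
  refine IsSelfAdjoint.pow (IsSelfAdjoint.smul (IsSelfAdjoint.all _) ?_) _
  have hA' : ∀ i, (A i)ᵀ = A i := fun i => by
    rw [← conjTranspose_eq_transpose_of_trivial]; exact hA i
  change (∑ σ, permProd A σ)ᴴ = _
  rw [conjTranspose_eq_transpose_of_trivial, transpose_sum]
  simp only [transpose_permProd hA']
  exact Equiv.sum_comp (Equiv.mulRight Fin.revPerm) fun σ => permProd A σ

/-- Combines the estimates on the individual orders in `η`: `h m` and `t m` stand for the
quadratic forms of the `m`-th power and of the sum over injections, and `Q` for the remaining
third-order contribution. -/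
theorem le_sum_range_of_order_bounds {n : ℕ} (hn0 : n ≠ 0) {η δ smax smin s Q : ℝ} (hη : 0 ≤ η)
    (hδ : 4 ≤ n → 0 ≤ δ) (hsmax0 : 0 ≤ smax) (hs0 : 0 ≤ s) {h t : ℕ → ℝ} (hnn : ∀ m, 0 ≤ h m)
    (hle : ∀ m, h m ≤ smax ^ m * s) (ht0 : t 0 = h 0) (ht1 : t 1 = h 1) (ht2 : t 2 = h 2 - h 1)
    (ht3 : t 3 = h 3 - 2 * h 2 - Q + 2 * h 1) (htlt : ∀ m, n < m → t m = 0)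
    (htm : 4 ≤ n → ∀ l, |t (l + 1)| ≤ (n : ℝ) ^ l * δ ^ l * h 1)
    (hsecond : ((n : ℝ) - 1) * (1 - δ) * (smin * s) ≤ n * h 1 - h 2)
    (hthird : 2 * h 2 - 2 * h 1 + Q
      ≤ √(n : ℝ) * √((n : ℝ) ^ 2 * δ ^ 4 + 6 * (n : ℝ) * δ ^ 2 + 1) * h 1) :
    (η ^ 2 * ((n : ℝ) - 1) * (1 - δ) * smin / (2 * (n : ℝ))
          - ∑ m ∈ Finset.Icc 4 n, η ^ m * (smax ^ m + smax * (n : ℝ) ^ (m - 1) * δ ^ (m - 1))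
          - (η ^ 3 / 6) * (3 * smax ^ 3 / (n : ℝ)
              + smax * Real.sqrt (n : ℝ) *
                Real.sqrt ((n : ℝ) ^ 2 * δ ^ 4 + 6 * (n : ℝ) * δ ^ 2 + 1))) * s
      ≤ ∑ m ∈ Finset.range (n + 1), ((-η) ^ m * (n.choose m / (n : ℝ) ^ m) * h m
        - (-η) ^ m * (m.factorial : ℝ)⁻¹ * t m) := by
  have hn : (1 : ℝ) ≤ n := by exact_mod_cast Nat.one_le_iff_ne_zero.2 hn0
  set a : ℕ → ℝ := fun m => (-η) ^ m * (n.choose m / (n : ℝ) ^ m) * h m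
    - (-η) ^ m * (m.factorial : ℝ)⁻¹ * t m with ha
  have ha0 : ∀ m, n < m → a m = 0 := fun m hm => by
    simp [ha, htlt m hm, Nat.choose_eq_zero_of_lt hm]
  have hsplit : ∑ m ∈ Finset.range (n + 1), a m
      = ∑ m ∈ Finset.range 4, a m + ∑ m ∈ Finset.Icc 4 n, a m := by
    rw [← Finset.sum_union]
    · refine Finset.sum_subset (fun m hm => ?_) fun m _ hm => ha0 m ?_
      · simp only [Finset.mem_union, Finset.mem_range, Finset.mem_Icc] at hm ⊢
        omega
      · simp only [Finset.mem_range] at hm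
        omega
    · rw [Finset.disjoint_left]
      intro m hm
      simp only [Finset.mem_range, Finset.mem_Icc] at hm ⊢
      omega
  have htail : ∀ m ∈ Finset.Icc 4 n,
      -(η ^ m * (smax ^ m + smax * (n : ℝ) ^ (m - 1) * δ ^ (m - 1)) * s) ≤ a m := by
    intro m hm
    obtain ⟨hm4, hmn⟩ := Finset.mem_Icc.1 hm
    have hδ0 : 0 ≤ δ := hδ (by omega)
    obtain ⟨l, rfl⟩ : ∃ l, m = l + 1 := ⟨m - 1, by omega⟩
    have htl : |t (l + 1)| ≤ smax * (n : ℝ) ^ l * δ ^ l * s := by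
      refine (htm (by omega) l).trans ?_
      have := mul_le_mul_of_nonneg_left (hle 1) (show 0 ≤ (n : ℝ) ^ l * δ ^ l by positivity)
      rw [pow_one] at this
      linarith
    have hch : ((n.choose (l + 1) : ℝ) / (n : ℝ) ^ (l + 1)) ≤ 1 := by
      rw [div_le_one (by positivity)]
      exact_mod_cast Nat.choose_le_pow n (l + 1)
    have hfac : ((l + 1).factorial : ℝ)⁻¹ ≤ 1 :=
      inv_le_one_of_one_le₀ (by exact_mod_cast Nat.one_le_iff_ne_zero.2 (Nat.factorial_ne_zero _))
    have hfac0 : 0 ≤ ((l + 1).factorial : ℝ)⁻¹ := by positivity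
    have habs : |a (l + 1)| ≤ η ^ (l + 1) * (1 * h (l + 1)) + η ^ (l + 1) * (1 * |t (l + 1)|) := by
      refine (abs_sub _ _).trans (add_le_add ?_ ?_)
      · rw [abs_mul, abs_mul, abs_pow, abs_neg, abs_of_nonneg hη, abs_of_nonneg (hnn _),
          abs_of_nonneg (by positivity), mul_assoc]
        have := hnn (l + 1)
        gcongr
      · rw [abs_mul, abs_mul, abs_pow, abs_neg, abs_of_nonneg hη, abs_of_nonneg hfac0, mul_assoc]
        gcongr
    have hpow : 0 ≤ η ^ (l + 1) := by positivity
    have := mul_le_mul_of_nonneg_left (add_le_add (hle (l + 1)) htl) hpow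
    rw [Nat.add_sub_cancel]
    linarith [neg_abs_le (a (l + 1))]
  have htail' := Finset.sum_le_sum htail
  rw [Finset.sum_neg_distrib, ← Finset.sum_mul] at htail'
  have hch2 : (n.choose 2 : ℝ) = n * (n - 1) / 2 := Nat.cast_choose_two ℝ n
  have hch3 : (n.choose 3 : ℝ) = n * (n - 1) * (n - 2) / 6 := by
    rw [Nat.cast_choose_eq_descPochhammer_div]
    simp [descPochhammer_succ_right, Nat.factorial]
  have ha2 : η ^ 2 * ((n : ℝ) - 1) * (1 - δ) * smin / (2 * (n : ℝ)) * s ≤ a 2 := by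
    have e : a 2 = η ^ 2 / (2 * n) * (n * h 1 - h 2) := by
      simp only [ha, ht2, hch2, Nat.factorial]
      push_cast
      field_simp
      ring
    rw [e]
    calc _ = η ^ 2 / (2 * n) * ((n - 1) * (1 - δ) * (smin * s)) := by ring
      _ ≤ _ := by gcongr
  have ha3 : -((η ^ 3 / 6) * (3 * smax ^ 3 / (n : ℝ) + smax * Real.sqrt (n : ℝ) *
      Real.sqrt ((n : ℝ) ^ 2 * δ ^ 4 + 6 * (n : ℝ) * δ ^ 2 + 1)) * s) ≤ a 3 := by
    have e : a 3 = -(η ^ 3 / 6 * (2 * h 2 - 2 * h 1 + Q - (3 * n - 2) / n ^ 2 * h 3)) := by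
      simp only [ha, ht3, hch3, Nat.factorial]
      push_cast
      field_simp
      ring
    have h3 : 0 ≤ (3 * n - 2) / (n : ℝ) ^ 2 * h 3 :=
      mul_nonneg (div_nonneg (by linarith) (by positivity)) (hnn 3)
    have h4 := hthird.trans (mul_le_mul_of_nonneg_left (hle 1) (by positivity))
    have h5 : 0 ≤ 3 * smax ^ 3 / (n : ℝ) * s := by positivity
    rw [e, neg_le_neg_iff, mul_assoc]
    refine mul_le_mul_of_nonneg_left ?_ (by positivity)
    rw [pow_one] at h4
    linarith
  have ha00 : a 0 = 0 := by simp [ha, ht0]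
  have ha11 : a 1 = 0 := by
    simp only [ha, ht1, Nat.choose_one_right, pow_one, Nat.factorial_one]
    field_simp
    simp
  rw [hsplit, Finset.sum_range_succ, Finset.sum_range_succ, Finset.sum_range_succ,
    Finset.sum_range_one, ha00, ha11]
  rw [sub_mul, sub_mul]
  linarith

end Means

/-- Lower bound on the minimum eigenvalue of W_GD(n,1) − W_RS(n,1), expressed as
the positive semidefiniteness of W_GD − W_RS − (bound)·I.  Here x_1,…,x_n are unit vectors in
ℝ^d (d ≤ n) with |xᵢᵀxⱼ| ≤ δ for i ≠ j, and s_max, s_min are the maximum and minimum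
eigenvalues of Σᵢ xᵢxᵢᵀ. -/
theorem statement7 (n d : ℕ) (hd : d ≤ n) (x : Fin n → Fin d → ℝ) (δ smax smin η : ℝ)
    (hη : 0 ≤ η)
    (hunit : ∀ i, x i ⬝ᵥ x i = 1)
    (hδ : ∀ i j, i ≠ j → |x i ⬝ᵥ x j| ≤ δ)
    (hH : (∑ i : Fin n, Matrix.vecMulVec (x i) (x i)).IsHermitian)
    (hsmax : smax = ⨆ k, hH.eigenvalues k)
    (hsmin : smin = ⨅ k, hH.eigenvalues k) :
    (WGD n 1 (fun i => 1 - η • Matrix.vecMulVec (x i) (x i))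
      - WRS n 1 (fun i => 1 - η • Matrix.vecMulVec (x i) (x i))
      - (η ^ 2 * ((n : ℝ) - 1) * (1 - δ) * smin / (2 * (n : ℝ))
          - ∑ m ∈ Finset.Icc 4 n, η ^ m * (smax ^ m + smax * (n : ℝ) ^ (m - 1) * δ ^ (m - 1))
          - (η ^ 3 / 6) * (3 * smax ^ 3 / (n : ℝ)
              + smax * Real.sqrt (n : ℝ) *
                Real.sqrt ((n : ℝ) ^ 2 * δ ^ 4 + 6 * (n : ℝ) * δ ^ 2 + 1))) •
          (1 : Matrix (Fin d) (Fin d) ℝ)).PosSemidef := by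
  rcases Nat.eq_zero_or_pos d with rfl | hd0
  · rw [Subsingleton.elim (_ - _ - _) (0 : Matrix (Fin 0) (Fin 0) ℝ)]
    exact PosSemidef.zero
  have hn0 : n ≠ 0 := by omega
  have : Nonempty (Fin n) := ⟨⟨0, by omega⟩⟩
  have hP : ∀ i, (1 - η • vecMulVec (x i) (x i)).IsHermitian := fun i => by
    ext a b
    simp [vecMulVec_apply, one_apply, eq_comm, mul_comm]
  have k0 : Fin d := ⟨0, hd0⟩
  have hPP : ∀ i, vecMulVec (x i) (x i) * vecMulVec (x i) (x i) = vecMulVec (x i) (x i) :=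
    fun i => vecMulVec_mul_self_of_unit _ (hunit i)
  have hpsd : (∑ i, vecMulVec (x i) (x i)).PosSemidef := by
    refine .of_dotProduct_mulVec_nonneg hH fun v => ?_
    rw [star_trivial v, ← quadVal_apply, quadVal_gram]
    positivity
  have hev0 : ∀ k, 0 ≤ hH.eigenvalues k := fun k => hpsd.eigenvalues_nonneg k
  have hmax : ∀ k, hH.eigenvalues k ≤ smax := fun k => by
    rw [hsmax]; exact le_ciSup (Set.finite_range _).bddAbove k
  have hmin : ∀ k, smin ≤ hH.eigenvalues k := fun k => by
    rw [hsmin]; exact ciInf_le (Set.finite_range _).bddBelow k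
  have hsmin0 : 0 ≤ smin := by rw [hsmin]; exact Real.iInf_nonneg hev0
  have hsmax0 : 0 ≤ smax := (hev0 k0).trans (hmax k0)
  refine .of_dotProduct_mulVec_nonneg ?_ fun v => ?_
  · refine ((WGD_isHermitian 1 hP).sub (WRS_isHermitian 1 hP)).sub ?_
    exact IsSelfAdjoint.smul (IsSelfAdjoint.all (_ : ℝ)) (IsSelfAdjoint.one _)
  rw [star_trivial, ← quadVal_apply, map_sub, map_sub, map_smul, quadVal_one,
    WGD_one_eq_sum x η hn0, WRS_one_eq_sum, map_sum, map_sum]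
  simp only [map_smul, smul_eq_mul]
  rw [← Finset.sum_sub_distrib, sub_nonneg]
  obtain ⟨c, hc⟩ := exists_quadVal_pow_eq hH v
  set s := v ⬝ᵥ v
  have hsc : s = ∑ k, c k ^ 2 := by
    have := hc 0
    simpa [quadVal_one] using this
  have hs0 : 0 ≤ s := by rw [hsc]; positivity
  let h : ℕ → ℝ := fun m => quadVal v ((∑ i, vecMulVec (x i) (x i)) ^ m)
  have hle : ∀ m, h m ≤ smax ^ m * s := fun m => by
    rw [hsc, Finset.mul_sum]
    refine (hc m).trans_le (Finset.sum_le_sum fun k _ => ?_)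
    exact mul_le_mul_of_nonneg_right (pow_le_pow_left₀ (hev0 k) (hmax k) m) (sq_nonneg _)
  have hnn : ∀ m, 0 ≤ h m := fun m => (hc m).ge.trans'
    (Finset.sum_nonneg fun k _ => mul_nonneg (pow_nonneg (hev0 k) m) (sq_nonneg _))
  have hge : smin * s ≤ h 1 := by
    rw [hsc, Finset.mul_sum]
    refine (Finset.sum_le_sum fun k _ => ?_).trans_eq (hc 1).symm
    rw [pow_one]
    exact mul_le_mul_of_nonneg_right (hmin k) (sq_nonneg _)
  have h1 : h 1 = ∑ i, (x i ⬝ᵥ v) ^ 2 := by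
    simp only [h, pow_one, quadVal_gram]
  have h2 : h 2 = ∑ i, ∑ j, (x i ⬝ᵥ x j) * ((x i ⬝ᵥ v) * (x j ⬝ᵥ v)) := by
    simp only [h, quadVal_gram_sq]
  let t : ℕ → ℝ := fun m => quadVal v (injProdSum (fun i => vecMulVec (x i) (x i)) m)
  have ht0 : t 0 = h 0 := by simp only [t, h, injProdSum_zero, pow_zero]
  have ht1 : t 1 = h 1 := by simp only [t, h, injProdSum_one, pow_one]
  have ht2 : t 2 = h 2 - h 1 := by
    simp only [t, h, injProdSum_two _ hPP, map_sub, pow_one]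
  have ht3 : t 3 = h 3 - 2 * h 2 - (∑ i, (∑ j, (x i ⬝ᵥ x j) ^ 2) * (x i ⬝ᵥ v) ^ 2) + 2 * h 1 := by
    rw [← quadVal_sum_vecMulVec_gram]
    simp only [t, h, injProdSum_three _ hPP, map_sub, map_add, pow_one, two_mul]
  have hG1 : ∀ i j, |x i ⬝ᵥ x j| ≤ 1 := fun i j => by
    have hcs := Finset.sum_mul_sq_le_sq_mul_sq Finset.univ (x i) (x j)
    have e : ∀ i, ∑ k, x i k ^ 2 = 1 := fun i => by
      rw [← hunit i]; simp only [dotProduct, pow_two]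
    rw [e, e, mul_one] at hcs
    exact abs_le_one_iff_mul_self_le_one.2 (by rw [← pow_two]; exact hcs)
  have hsecond := second_order_gram_ge hunit hG1 hδ (fun i => x i ⬝ᵥ v)
    (mul_nonneg hsmin0 hs0) (h1 ▸ hge)
  have hthird := third_order_gram_le hunit hδ fun i => x i ⬝ᵥ v
  rw [Fintype.card_fin, ← h1, ← h2] at hsecond hthird
  exact le_sum_range_of_order_bounds hn0 hη (h := h) (t := t)
    (fun h4 => (abs_nonneg _).trans
      (hδ ⟨0, by omega⟩ ⟨1, by omega⟩ (by simp [Fin.ext_iff])))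
    hsmax0 hs0 hnn hle ht0 ht1 ht2 ht3
    (fun m hm => by simp only [t, injProdSum_of_lt _ hm, map_zero])
    (fun h4 l => h1 ▸ abs_quadVal_injProdSum_le ((abs_nonneg _).trans
      (hδ ⟨0, by omega⟩ ⟨1, by omega⟩ (by simp [Fin.ext_iff]))) hδ v l)
    hsecond hthird
end
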